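/- Let p, b, c, d be nonnegative integers with d ≤ min(b, c), and set a = 2p. With the block decomposition Q(a,b,c,d,p) = [[Q2, Q1],[Q3, Q4]] (Q2 the a×a block of entries C(b+c, c−i+j), Q1 the a×d block of entries C(2j−1, j−i+p), Q3 the d×a block of entries C(b+c−2i+1, c−i+j−p), Q4 the d×d block of entries C(2(j−i), j−i)) and F := Q4 − Q3·Q2^{−1}·Q1, the determinant of F factors as det F = 4^{dp} · ∏_{k=1}^{d} (k−1/2)_p · (b−k+1)_p · (c−k+1)_p / ( (k)_p · (b+c−2k+2)_{2p} ), where (x)_n denotes the Pochhammer symbol (rising factorial) over ℚ. -/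

import Mathlib

open Finset

noncomputable section

/-- Binomial coefficient with integer arguments, equal to `0` whenever `k < 0` or `k > n`. -/
def ibinom (n k : ℤ) : ℚ :=
  if 0 ≤ k ∧ k ≤ n then (n.toNat.choose k.toNat : ℚ) else 0

/-- The Pochhammer symbol (rising factorial) `x (x+1) ⋯ (x+n-1)`. -/
def poch (x : ℚ) (n : ℕ) : ℚ := (ascPochhammer ℚ n).eval x

/-- MacMahon's product `M(a,b,c)`. -/
def macmahon (a b c : ℕ) : ℚ :=
  ∏ i ∈ Finset.range a,
    ((Nat.factorial i : ℚ) * (Nat.factorial (b + c + i) : ℚ)) /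
      ((Nat.factorial (b + i) : ℚ) * (Nat.factorial (c + i) : ℚ))

/-- The matrix `Q(a,b,c,d,p)` (with `1`-based indices `i, j ∈ {1, …, a+d}`):
rows/columns with index `≤ a` are lateral, the rest are intrusive. -/
def Qmat (a b c d : ℕ) (p : ℤ) : Matrix (Fin (a + d)) (Fin (a + d)) ℚ :=
  Matrix.of fun i j =>
    if (i : ℕ) < a then
      if (j : ℕ) < a then
        ibinom ((b : ℤ) + c) ((c : ℤ) - (((i : ℕ) : ℤ) + 1) + (((j : ℕ) : ℤ) + 1))
      else
        ibinom (2 * (((j : ℕ) : ℤ) - a + 1) - 1)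
          ((((j : ℕ) : ℤ) - a + 1) - (((i : ℕ) : ℤ) + 1) + p)
    else
      if (j : ℕ) < a then
        ibinom ((b : ℤ) + c - 2 * (((i : ℕ) : ℤ) - a + 1) + 1)
          ((c : ℤ) - (((i : ℕ) : ℤ) - a + 1) + (((j : ℕ) : ℤ) + 1) - p)
      else
        ibinom (2 * (((j : ℕ) : ℤ) - ((i : ℕ) : ℤ))) (((j : ℕ) : ℤ) - ((i : ℕ) : ℤ))

/-- `E(a,b,c,d,p) = det Q(a,b,c,d,p)`, the signed count of lozenge tilings of the
`(a,b,c)`-hexagon with an even intrusion of length `d` at position `p`. -/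
def E (a b c d : ℕ) (p : ℤ) : ℚ := (Qmat a b c d p).det

open Polynomial in
lemma shift_pow (r : ℕ) : ∃ l : ℚ[X], (X * l).natDegree ≤ r ∧
    X * (X + 1) ^ r = X ^ (r + 1) + C (r : ℚ) * X ^ r + l := by
  induction r with
  | zero => exact ⟨0, by simp, by simp⟩
  | succ r ih =>
    obtain ⟨l, hl, h⟩ := ih
    refine ⟨C (r : ℚ) * X ^ r + (X + 1) * l, ?_, ?_⟩
    · have e : X * (C (r : ℚ) * X ^ r + (X + 1) * l) = C (r : ℚ) * X ^ (r + 1) + (X + 1) * (X * l) := by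
        ring
      rw [e]
      refine (natDegree_add_le _ _).trans (max_le ?_ ?_)
      · exact natDegree_C_mul_X_pow_le _ _
      · refine natDegree_mul_le.trans ?_
        have : (X + 1 : ℚ[X]).natDegree ≤ 1 := by compute_degree
        omega
    · have : X * (X + 1) ^ (r + 1) = (X * (X + 1) ^ r) * (X + 1 : ℚ[X]) := by ring
      rw [this, h]
      push_cast
      simp only [C_add, C_1]
      ring

/-- monic cubic with given roots -/
def cub (a : Fin 3 → ℚ) : Polynomial ℚ := ∏ i, (Polynomial.X - Polynomial.C (a i))

open Polynomial in
lemma cub_form (a : Fin 3 → ℚ) : ∃ A' : ℚ[X], A'.natDegree ≤ 1 ∧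
    cub a = X ^ 3 - C (∑ i, a i) * X ^ 2 + A' := by
  refine ⟨C (a 0 * a 1 + a 0 * a 2 + a 1 * a 2) * X - C (a 0 * a 1 * a 2), by compute_degree, ?_⟩
  simp only [cub, Fin.prod_univ_three, Fin.sum_univ_three, C_add, C_mul]
  ring

/-- the Gosper operator -/
def gosp (a b : Fin 3 → ℚ) : Polynomial ℚ →ₗ[ℚ] Polynomial ℚ where
  toFun g := cub a * g.comp (Polynomial.X + 1) - cub b * g
  map_add' f g := by simp only [Polynomial.add_comp]; ring
  map_smul' r g := by simp [smul_sub]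

lemma gosp_apply (a b : Fin 3 → ℚ) (g : Polynomial ℚ) :
    gosp a b g = cub a * g.comp (Polynomial.X + 1) - cub b * g := rfl

lemma gosp_eval (a b : Fin 3 → ℚ) (g : Polynomial ℚ) (x : ℚ) :
    (gosp a b g).eval x = (cub a).eval x * g.eval (x + 1) - (cub b).eval x * g.eval x := by
  simp [gosp_apply]

open Polynomial in
lemma gosp_deg (a b : Fin 3 → ℚ) (q : ℕ) (h : ∑ i, b i - ∑ i, a i = -3 * q) :
    ∀ g ∈ degreeLT ℚ (3 * q + 1), gosp a b g ∈ degreeLT ℚ (3 * q + 2) := by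
  have key : degreeLT ℚ (3 * q + 1) ≤ (degreeLT ℚ (3 * q + 2)).comap (gosp a b) := by
    rw [degreeLT_eq_span_X_pow, Submodule.span_le]
    intro g hg
    simp only [Finset.coe_image, Set.mem_image, Finset.coe_range, Set.mem_Iio] at hg
    obtain ⟨r, hr, rfl⟩ := hg
    show gosp a b (X ^ r) ∈ degreeLT ℚ (3 * q + 2)
    rw [mem_degreeLT]
    obtain ⟨A', hA', hA⟩ := cub_form a
    obtain ⟨B', hB', hB⟩ := cub_form b
    obtain ⟨l, hl, hlp⟩ := shift_pow r
    have e : gosp a b (X ^ r) = C ((r : ℚ) - 3 * q) * X ^ (r + 2) +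
        (X * (X * l) - C (∑ i, a i) * (C (r : ℚ) * X ^ (r + 1) + X * l) + A' * (X + 1) ^ r
          - B' * X ^ r) := by
      have h2 : (r : ℚ) - 3 * q = r + ∑ i, b i - ∑ i, a i := by linarith
      rw [gosp_apply, X_pow_comp, hA, hB, h2, C_sub, C_add]
      linear_combination (X ^ 2 - C (∑ i, a i) * X) * hlp
    have hs : (X * (X * l) - C (∑ i, a i) * (C (r : ℚ) * X ^ (r + 1) + X * l) + A' * (X + 1) ^ r
          - B' * X ^ r).natDegree ≤ r + 1 := by
      have h1 : (X * (X * l)).natDegree ≤ r + 1 := by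
        refine natDegree_mul_le.trans ?_
        have : (X : ℚ[X]).natDegree ≤ 1 := by compute_degree
        omega
      have h2 : (C (∑ i, a i) * (C (r : ℚ) * X ^ (r + 1) + X * l)).natDegree ≤ r + 1 := by
        refine (natDegree_C_mul_le _ _).trans ((natDegree_add_le _ _).trans (max_le ?_ (by omega)))
        exact natDegree_C_mul_X_pow_le _ _
      have h3 : (A' * (X + 1) ^ r).natDegree ≤ r + 1 := by
        refine natDegree_mul_le.trans ?_
        have : ((X + 1 : ℚ[X]) ^ r).natDegree ≤ r := by compute_degree
        omega
      have h4 : (B' * X ^ r).natDegree ≤ r + 1 := by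
        refine natDegree_mul_le.trans ?_
        have : ((X : ℚ[X]) ^ r).natDegree ≤ r := by compute_degree
        omega
      exact (natDegree_sub_le_of_le ((natDegree_add_le_of_le ((natDegree_sub_le_of_le h1 h2)) h3)) h4).trans (by simp)
    have hfin : (gosp a b (X ^ r)).natDegree ≤ 3 * q + 1 := by
      rw [e]
      refine natDegree_add_le_of_degree_le ?_ (hs.trans (by omega))
      rcases Nat.lt_or_ge r (3 * q) with h5 | h5
      · exact (natDegree_C_mul_X_pow_le _ _).trans (by omega)
      · have : r = 3 * q := by omega
        subst this
        simp
    refine lt_of_le_of_lt degree_le_natDegree ?_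
    exact_mod_cast Nat.lt_succ_of_le hfin
  exact fun g hg => key hg

lemma cub_eval (a : Fin 3 → ℚ) (x : ℚ) : (cub a).eval x = ∏ i, (x - a i) := by
  simp [cub, Polynomial.eval_prod]

open Polynomial in
lemma gosp_inj (a b : Fin 3 → ℚ) (i0 : Fin 3) (h : ∀ (s : ℕ) (j : Fin 3), a i0 - s ≠ b j)
    (g : ℚ[X]) (hg : gosp a b g = 0) : g = 0 := by
  have hB : ∀ s : ℕ, (cub b).eval (a i0 - s) ≠ 0 := by
    intro s
    rw [cub_eval, Finset.prod_ne_zero_iff]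
    intro j _
    exact sub_ne_zero.mpr (h s j)
  have hz : ∀ s : ℕ, g.eval (a i0 - s) = 0 := by
    intro s
    have h1 := gosp_eval a b g (a i0 - s)
    rw [hg, eval_zero] at h1
    induction s with
    | zero =>
      have : (cub a).eval (a i0 - (0 : ℕ)) = 0 := by
        rw [cub_eval]; exact Finset.prod_eq_zero (Finset.mem_univ i0) (by simp)
      rw [this] at h1
      have := hB 0
      simp only [zero_mul, zero_sub] at h1
      have h1 := neg_eq_zero.mp h1.symm
      exact (mul_eq_zero.mp h1).resolve_left this
    | succ s ih =>
      have h2 := gosp_eval a b g (a i0 - s)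
      rw [hg, eval_zero] at h2
      have h3 := ih h2
      have : a i0 - ((s + 1 : ℕ) : ℚ) + 1 = a i0 - s := by push_cast; ring
      rw [this, h3, mul_zero, zero_sub] at h1
      exact (mul_eq_zero.mp (neg_eq_zero.mp h1.symm)).resolve_left (hB _)
  apply eq_zero_of_infinite_isRoot
  refine Set.Infinite.mono (s := Set.range fun s : ℕ => a i0 - (s : ℚ)) ?_ ?_
  · rintro _ ⟨s, rfl⟩
    exact hz s
  · apply Set.infinite_range_of_injective
    intro s t hst
    simp only [sub_right_inj, Nat.cast_inj] at hst
    exact hst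

lemma finrank_degLT (n : ℕ) : Module.finrank ℚ (Polynomial.degreeLT ℚ n) = n := by
  rw [(Polynomial.degreeLTEquiv ℚ n).finrank_eq]; simp

/-- if a nonzero functional vanishes on Gosper images then its kernel consists of them -/
lemma gosp_surj (a b : Fin 3 → ℚ) (q : ℕ) (h : ∑ i, b i - ∑ i, a i = -3 * q)
    (i0 : Fin 3) (h0 : ∀ (s : ℕ) (j : Fin 3), a i0 - s ≠ b j)
    (c : Polynomial ℚ →ₗ[ℚ] ℚ) (hc : ∀ g, c (gosp a b g) = 0)
    (hne : ∃ f ∈ Polynomial.degreeLT ℚ (3 * q + 2), c f ≠ 0) :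
    ∀ f ∈ Polynomial.degreeLT ℚ (3 * q + 2), c f = 0 →
      ∃ g ∈ Polynomial.degreeLT ℚ (3 * q + 1), gosp a b g = f := by
  let Θ := (gosp a b).restrict (gosp_deg a b q h)
  let c' : Module.Dual ℚ (Polynomial.degreeLT ℚ (3 * q + 2)) := c.domRestrict _
  have : ∀ n, FiniteDimensional ℚ (Polynomial.degreeLT ℚ n) := fun n =>
    Module.Finite.equiv (Polynomial.degreeLTEquiv ℚ n).symm
  have hc' : c' ≠ 0 := by
    obtain ⟨f, hf, hcf⟩ := hne
    intro h
    exact hcf (LinearMap.congr_fun h ⟨f, hf⟩)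
  have h1 := Module.Dual.finrank_ker_add_one_of_ne_zero hc'
  have hinj : Function.Injective Θ := by
    rw [injective_iff_map_eq_zero]
    intro g hg
    have := gosp_inj a b i0 h0 g (congrArg Subtype.val hg)
    exact Subtype.ext this
  have h2 := LinearMap.finrank_range_of_inj hinj
  have hle : LinearMap.range Θ ≤ LinearMap.ker c' := by
    rintro _ ⟨g, rfl⟩
    exact hc g
  have heq := Submodule.eq_of_le_of_finrank_eq hle (by
    rw [finrank_degLT] at h1 h2; omega)
  intro f hf hcf
  have : (⟨f, hf⟩ : Polynomial.degreeLT ℚ (3 * q + 2)) ∈ LinearMap.range Θ := by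
    rw [heq]; exact hcf
  obtain ⟨g, hg⟩ := this
  exact ⟨g, g.2, congrArg Subtype.val hg⟩

/-- bordering lemma -/
lemma border_det {S : Type*} [CommRing S] {ι ρ : Type*} [Fintype ι] [Fintype ρ] [DecidableEq ι]
    [DecidableEq ρ] (r : ℕ) (x : S) (M : Matrix ι (ι ⊕ ρ) S) (U : Matrix ι (Fin r) S)
    (V : Matrix (Fin r) (ι ⊕ ρ) S) (D : Matrix ρ (ι ⊕ ρ) S) :
    ∃ e, x ^ r * (Matrix.fromRows (x • M + U * V) D).det = x ^ Fintype.card ι * e := by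
  refine ⟨(Matrix.fromBlocks (Matrix.fromRows M D) (Matrix.fromRows U 0) (-V) (x • 1)).det, ?_⟩
  have h1 : (Matrix.fromBlocks (Matrix.fromRows (x • M) D) (Matrix.fromRows U 0) (-V) 1).det =
      (Matrix.fromRows (x • M + U * V) D).det := by
    rw [Matrix.det_fromBlocks_one₂₂]
    congr 1
    rw [Matrix.fromRows_mul]
    ext i j
    rcases i with i | i <;> simp
  have h2 : Matrix.fromBlocks (Matrix.fromRows (x • M) D) (Matrix.fromRows U 0) (-V) 1 *
      Matrix.fromBlocks 1 0 0 (x • (1 : Matrix (Fin r) (Fin r) S)) =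
      Matrix.fromBlocks (Matrix.fromBlocks (x • (1 : Matrix ι ι S)) 0 0 (1 : Matrix ρ ρ S)) 0 0 1 *
        Matrix.fromBlocks (Matrix.fromRows M D) (Matrix.fromRows U 0) (-V) (x • 1) := by
    rw [Matrix.fromBlocks_multiply, Matrix.fromBlocks_multiply, Matrix.fromBlocks_mul_fromRows,
      Matrix.fromBlocks_mul_fromRows]
    congr 1 <;> ext i j <;> rcases i with i | i <;> simp
  have h3 := congrArg Matrix.det h2
  rw [Matrix.det_mul, Matrix.det_mul, h1, Matrix.det_fromBlocks_zero₂₁, Matrix.det_fromBlocks_zero₂₁,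
    Matrix.det_fromBlocks_zero₂₁] at h3
  simp only [Matrix.det_one, Matrix.det_smul, Fintype.card_fin, mul_one, one_mul] at h3
  rw [mul_comm, h3]

open Polynomial in
lemma rank_dvd {p : ℕ} (G : Matrix (Fin p) (Fin p ⊕ Fin p) ℚ[X])
    (Cm : Matrix (Fin p) (Fin p ⊕ Fin p) ℚ) (ξ : ℚ) (r : ℕ) (hr : r ≤ p)
    (U : Matrix (Fin p) (Fin r) ℚ) (V : Matrix (Fin r) (Fin p ⊕ Fin p) ℚ) (lam : ℚ)
    (h : ∀ k l, (G k l).eval ξ = (U * V) k l + lam * Cm k l) :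
    (X - C ξ) ^ (p - r) ∣ (Matrix.fromRows G (Cm.map C)).det := by
  have h1 : ∀ k l, ∃ m, G k l - C ((G k l).eval ξ) = (X - C ξ) * m :=
    fun k l => X_sub_C_dvd_sub_C_eval
  choose M hM using h1
  obtain ⟨e, he⟩ := border_det r (X - C ξ) (Matrix.of M) (U.map C) (V.map C) (Cm.map C)
  have h2 : Matrix.fromRows G (Cm.map C) =
      Matrix.fromBlocks 1 (C lam • 1) 0 1 *
      Matrix.fromRows ((X - C ξ) • (Matrix.of M) + (U.map C) * (V.map C)) (Cm.map C) := by
    rw [Matrix.fromBlocks_mul_fromRows]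
    ext1 i j
    rcases i with i | i
    · have := hM i j
      have h3 := h i j
      rw [← Matrix.map_mul]
      simp only [Matrix.fromRows_apply_inl, Matrix.one_mul, Matrix.smul_mul, Matrix.add_apply,
        Matrix.smul_apply, Matrix.of_apply, Matrix.map_apply, smul_eq_mul, ← this, h3, C_add, C_mul]
      ring
    · simp
  have h4 : (Matrix.fromRows G (Cm.map C)).det =
      (Matrix.fromRows ((X - C ξ) • (Matrix.of M) + (U.map C) * (V.map C)) (Cm.map C)).det := by
    rw [h2, Matrix.det_mul, Matrix.det_fromBlocks_zero₂₁]; simp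
  rw [h4]
  have hpp : (X - C ξ) ^ p = (X - C ξ) ^ r * (X - C ξ) ^ (p - r) := by
    rw [← pow_add, Nat.add_sub_of_le hr]
  rw [Fintype.card_fin, hpp, mul_assoc] at he
  have hx : (X - C ξ) ^ r ≠ 0 := pow_ne_zero _ (X_sub_C_ne_zero ξ)
  exact ⟨e, mul_left_cancel₀ hx he⟩

/-- rank at most `r` modulo the line spanned by `Cm` -/
def RK {ι κ : Type*} (G Cm : ι → κ → ℚ) (r : ℕ) : Prop :=
  ∃ (u : Fin r → ι → ℚ) (v : Fin r → κ → ℚ) (lam : ℚ),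
    ∀ k l, G k l = ∑ s, u s k * v s l + lam * Cm k l

lemma RK.step {ι κ : Type*} {G Cm H : ι → κ → ℚ} {r : ℕ} (hG : RK G Cm r) (c e f : ℚ)
    (hc : c ≠ 0) (t : ι → ℚ) (w : κ → ℚ)
    (h : ∀ k l, c * H k l = e * G k l + t k * w l + f * Cm k l) : RK H Cm (r + 1) := by
  obtain ⟨u, v, lam, hu⟩ := hG
  refine ⟨Fin.cons (fun k => t k / c) (fun s k => e / c * u s k), Fin.cons w v,
    (e * lam + f) / c, fun k l => ?_⟩
  rw [Fin.sum_univ_succ]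
  simp only [Fin.cons_zero, Fin.cons_succ, mul_assoc, ← Finset.mul_sum]
  have h1 := h k l
  rw [hu k l] at h1
  field_simp
  linarith

lemma RK.zero {ι κ : Type*} (Cm : ι → κ → ℚ) : RK (fun _ _ => 0) Cm 0 :=
  ⟨fun _ _ => 0, fun _ _ => 0, 0, by simp⟩

lemma rk_up {ι κ : Type*} (G : ℚ → ι → κ → ℚ) (Cm : ι → κ → ℚ) (A B f : ℚ → ℚ)
    (t : ℚ → ι → ℚ) (w : ℚ → κ → ℚ)
    (h : ∀ x k l, A x * G (x + 1) k l = B x * G x k l + t x k * w x l + f x * Cm k l)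
    (q : ℕ) (x : ℚ) (hx : B x = 0) (hA : ∀ s : ℕ, s < q → A (x + s) ≠ 0) (r : ℕ) (hr : r < q) :
    RK (G (x + (r + 1))) Cm (r + 1) := by
  induction r with
  | zero =>
    have h0 := hA 0 hr
    simp only [Nat.cast_zero, add_zero, zero_add] at h0 ⊢
    refine (RK.zero Cm).step (A x) 0 (f x) h0 (t x) (w x) (fun k l => ?_)
    rw [h, hx]; ring
  | succ r ih =>
    have h0 := hA (r + 1) hr
    push_cast at h0 ⊢
    refine (ih (by omega)).step _ (B (x + (r + 1))) (f (x + (r + 1))) h0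
      (t (x + (r + 1))) (w (x + (r + 1))) (fun k l => ?_)
    rw [← h, ← add_assoc x (r + 1 : ℚ) 1]

lemma rk_down {ι κ : Type*} (G : ℚ → ι → κ → ℚ) (Cm : ι → κ → ℚ) (A B f : ℚ → ℚ)
    (t : ℚ → ι → ℚ) (w : ℚ → κ → ℚ)
    (h : ∀ x k l, A x * G (x + 1) k l = B x * G x k l + t x k * w x l + f x * Cm k l)
    (q : ℕ) (x : ℚ) (hx : A x = 0) (hB : ∀ s : ℕ, s < q → B (x - s) ≠ 0) (r : ℕ) (hr : r < q) :
    RK (G (x - r)) Cm (r + 1) := by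
  induction r with
  | zero =>
    have h0 := hB 0 hr
    simp only [Nat.cast_zero, sub_zero, zero_add] at h0 ⊢
    refine (RK.zero Cm).step (B x) 0 (-f x) h0 (fun k => - t x k) (w x) (fun k l => ?_)
    have := h x k l
    rw [hx] at this
    linarith
  | succ r ih =>
    have h0 := hB (r + 1) hr
    refine (ih (by omega)).step _ (A (x - (r + 1 : ℕ))) (-f (x - (r + 1 : ℕ))) h0
      (fun k => - t (x - (r + 1 : ℕ)) k) (w (x - (r + 1 : ℕ))) (fun k l => ?_)
    have := h (x - (r + 1 : ℕ)) k l
    have e : x - (r + 1 : ℕ) + 1 = x - r := by push_cast; ring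
    rw [e] at this
    linarith

lemma tel_prod (q : ℕ) (y e : ℚ) :
    (∏ r ∈ range q, (y + e * r) ^ (q - r)) * ∏ r ∈ range (q + 1), (y + e * r) =
      y ^ (q + 1) * ∏ r ∈ range q, (y + e * (r + 1)) ^ (q - r) := by
  have h1 : (∏ r ∈ range q, (y + e * r) ^ (q - r)) * ∏ r ∈ range (q + 1), (y + e * r) =
      ∏ r ∈ range (q + 1), (y + e * r) ^ (q + 1 - r) := by
    rw [prod_range_succ, ← mul_assoc, ← prod_mul_distrib, prod_range_succ _ q]
    congr 1
    · refine prod_congr rfl fun r hr => ?_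
      rw [mem_range] at hr
      rw [← pow_succ, show q + 1 - r = q - r + 1 by omega]
    · rw [show q + 1 - q = 1 by omega, pow_one]
  rw [h1, prod_range_succ', mul_comm]
  congr 1
  · simp
  · refine prod_congr rfl fun r hr => ?_
    simp only [Nat.add_sub_add_right, Nat.cast_add, Nat.cast_one]

/-- partial weighted sums -/
def Ls (W : ℕ → ℚ) (m : ℕ) : Polynomial ℚ →ₗ[ℚ] ℚ where
  toFun f := ∑ n ∈ range m, W n * f.eval (n : ℚ)
  map_add' f g := by simp [mul_add, sum_add_distrib]
  map_smul' r f := by simp [mul_sum, mul_left_comm]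

lemma Ls_apply (W : ℕ → ℚ) (m : ℕ) (f : Polynomial ℚ) :
    Ls W m f = ∑ n ∈ range m, W n * f.eval (n : ℚ) := rfl

lemma Ls_gosp (alp bet : Fin 3 → ℚ) (W : ℕ → ℚ)
    (hW : ∀ n : ℕ, W (n + 1) * (cub bet).eval ((n : ℚ) + 1) = W n * (cub alp).eval (n : ℚ))
    (hB0 : (cub bet).eval 0 = 0) (m : ℕ) (g : Polynomial ℚ) :
    Ls W m (gosp alp bet g) = W m * (cub bet).eval (m : ℚ) * g.eval (m : ℚ) := by
  rw [Ls_apply]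
  induction m with
  | zero => simp [hB0]
  | succ m ih =>
    rw [sum_range_succ, ih, gosp_eval]
    push_cast
    rw [hW]; ring

open Polynomial in
lemma gam_deg (q : ℕ) (G : Fin (q + 1) → Fin (q + 1) ⊕ Fin (q + 1) → ℚ[X])
    (hG : ∀ k l, G k l ∈ degreeLT ℚ (3 * q + 1))
    (Cm : Matrix (Fin (q + 1)) (Fin (q + 1) ⊕ Fin (q + 1)) ℚ) :
    (Matrix.fromRows (Matrix.of G) (Cm.map C)).det.natDegree ≤ 3 * q * (q + 1) := by
  rw [Matrix.det_apply]
  refine natDegree_sum_le_of_forall_le _ _ fun σ _ => ?_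
  refine (natDegree_smul_le _ _).trans ((natDegree_prod_le _ _).trans ?_)
  have hh : ∀ i, ((Matrix.fromRows (Matrix.of G) (Cm.map C)) i (σ.symm i)).natDegree ≤
      Sum.elim (fun _ : Fin (q + 1) => 3 * q) (fun _ : Fin (q + 1) => 0) i := by
    intro i
    rcases i with i | i
    · simp only [Matrix.fromRows_apply_inl, Matrix.of_apply, Sum.elim_inl]
      have := hG i (σ.symm (Sum.inl i))
      rw [mem_degreeLT] at this
      exact natDegree_le_of_degree_le (Order.le_of_lt_succ (by exact_mod_cast this))
    · simp
  rw [← Equiv.sum_comp σ.symm]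
  simp only [Equiv.apply_symm_apply]
  refine (Finset.sum_le_sum fun i _ => hh i).trans ?_
  rw [Fintype.sum_sum_type]
  simp [mul_comm]

/-- the forced roots -/
def xi (alp bet : Fin 3 → ℚ) (q : ℕ) (t : Bool × Fin 3 × Fin q) : ℚ :=
  bif t.1 then bet t.2.1 + ((t.2.2 : ℕ) + 1) else alp t.2.1 - (t.2.2 : ℕ)

/-- the forced factor -/
def PiP (alp bet : Fin 3 → ℚ) (q : ℕ) : Polynomial ℚ :=
  ∏ t : Bool × Fin 3 × Fin q,
    (Polynomial.X - Polynomial.C (xi alp bet q t)) ^ (q - (t.2.2 : ℕ))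

lemma PiP_deg (alp bet : Fin 3 → ℚ) (q : ℕ) : (PiP alp bet q).natDegree = 3 * q * (q + 1) := by
  rw [PiP, Polynomial.natDegree_prod_of_monic _ _
    (fun t _ => (Polynomial.monic_X_sub_C _).pow _)]
  simp only [Polynomial.natDegree_pow, Polynomial.natDegree_X_sub_C, mul_one]
  rw [Fintype.sum_prod_type]
  simp only [Fintype.sum_prod_type, sum_const, card_univ, Fintype.card_bool, Fintype.card_fin,
    smul_eq_mul]
  have h : ∑ x : Fin q, (q - (x : ℕ)) = ∑ x ∈ range q, (x + 1) := by
    rw [Fin.sum_univ_eq_sum_range (fun x => q - x) q, ← sum_range_reflect]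
    refine sum_congr rfl fun x hx => ?_
    rw [mem_range] at hx; omega
  rw [h, sum_add_distrib]
  have := Finset.sum_range_id_mul_two q
  simp only [sum_const, card_range, smul_eq_mul, mul_one]
  rcases q with _ | q
  · simp
  · simp only [Nat.add_sub_cancel] at this
    nlinarith

lemma PiP_eval (alp bet : Fin 3 → ℚ) (q : ℕ) (x : ℚ) : (PiP alp bet q).eval x =
    (∏ i, ∏ r ∈ range q, (x - bet i - (r + 1)) ^ (q - r)) *
      ∏ i, ∏ r ∈ range q, (x - alp i + r) ^ (q - r) := by
  rw [PiP, Polynomial.eval_prod, Fintype.prod_prod_type]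
  simp only [Fintype.prod_prod_type, Fintype.prod_bool, xi, cond_true, cond_false,
    Polynomial.eval_pow, Polynomial.eval_sub, Polynomial.eval_X, Polynomial.eval_C]
  congr 1
  · refine prod_congr rfl fun i _ => ?_
    rw [← Fin.prod_univ_eq_prod_range (fun r => (x - bet i - ((r : ℚ) + 1)) ^ (q - r)) q]
    refine prod_congr rfl fun r _ => ?_
    congr 1; ring
  · refine prod_congr rfl fun i _ => ?_
    rw [← Fin.prod_univ_eq_prod_range (fun r => (x - alp i + (r : ℚ)) ^ (q - r)) q]
    refine prod_congr rfl fun r _ => ?_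
    congr 1; ring

lemma PiP_shift (alp bet : Fin 3 → ℚ) (q : ℕ) (x : ℚ) :
    (cub alp).eval x ^ (q + 1) * (PiP alp bet q).eval (x + 1) *
        ∏ i, ∏ r ∈ range (q + 1), (x - bet i - r) =
      (cub bet).eval x ^ (q + 1) * (PiP alp bet q).eval x *
        ∏ i, ∏ r ∈ range (q + 1), (x - alp i + r) := by
  have h1 : ∀ i, (∏ r ∈ range q, (x + 1 - bet i - (r + 1)) ^ (q - r)) *
      ∏ r ∈ range (q + 1), (x - bet i - r) =
      (x - bet i) ^ (q + 1) * ∏ r ∈ range q, (x - bet i - (r + 1)) ^ (q - r) := by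
    intro i
    have := tel_prod q (x - bet i) (-1)
    simp only [neg_mul, one_mul, ← sub_eq_add_neg] at this
    rw [← this]
    congr 1
    refine prod_congr rfl fun r _ => ?_
    congr 1; ring
  have h2 : ∀ i, (∏ r ∈ range q, (x - alp i + r) ^ (q - r)) *
      ∏ r ∈ range (q + 1), (x - alp i + r) =
      (x - alp i) ^ (q + 1) * ∏ r ∈ range q, (x + 1 - alp i + r) ^ (q - r) := by
    intro i
    have := tel_prod q (x - alp i) 1
    simp only [one_mul] at this
    rw [this]
    congr 1
    refine prod_congr rfl fun r _ => ?_
    congr 1; ring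
  rw [PiP_eval, PiP_eval, cub_eval, cub_eval, ← prod_pow, ← prod_pow]
  have e1 := prod_congr (rfl : (univ : Finset (Fin 3)) = univ) fun i _ => h1 i
  have e2 := prod_congr (rfl : (univ : Finset (Fin 3)) = univ) fun i _ => h2 i
  simp only [prod_mul_distrib] at e1 e2
  linear_combination (∏ i, (x - alp i) ^ (q + 1)) *
    (∏ i, ∏ r ∈ range q, (x + 1 - alp i + r) ^ (q - r)) * e1
    - (∏ i, (x - bet i) ^ (q + 1)) *
    (∏ i, ∏ r ∈ range q, (x - bet i - (r + 1)) ^ (q - r)) * e2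

/-- the basic determinant -/
def Phi (q M : ℕ) (W : ℕ → ℚ) (τ : Fin (q + 1) → Polynomial ℚ)
    (π : Fin (q + 1) ⊕ Fin (q + 1) → Polynomial ℚ) (m : ℕ) : ℚ :=
  (Matrix.fromRows (Matrix.of fun k l => Ls W m (τ k * π l))
    (Matrix.of fun k l => Ls W M (τ k * π l))).det

open Polynomial in
lemma mul_mem_degLT (q : ℕ) (f g : ℚ[X]) (hf : f ∈ degreeLT ℚ (q + 1))
    (hg : g ∈ degreeLT ℚ (2 * q + 2)) : f * g ∈ degreeLT ℚ (3 * q + 2) := by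
  rw [mem_degreeLT] at *
  have h1 : f.natDegree ≤ q :=
    natDegree_le_of_degree_le (Order.le_of_lt_succ (by exact_mod_cast hf))
  have h2 : g.natDegree ≤ 2 * q + 1 :=
    natDegree_le_of_degree_le (Order.le_of_lt_succ (by exact_mod_cast hg))
  refine lt_of_le_of_lt degree_le_natDegree ?_
  have := natDegree_mul_le (p := f) (q := g)
  exact_mod_cast (by omega : (f * g).natDegree < 3 * q + 2)

lemma pow_dvd_gam (alp bet : Fin 3 → ℚ) (q : ℕ)
    (hab : ∀ i j, ∀ s : ℕ, s ≤ 2 * q → alp i ≠ bet j + s)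
    (hbb : ∀ i j, i ≠ j → ∀ s : ℕ, s ≤ q → bet i ≠ bet j + s)
    (haa : ∀ i j, i ≠ j → ∀ s : ℕ, s ≤ q → alp i ≠ alp j + s)
    (G : Fin (q + 1) → Fin (q + 1) ⊕ Fin (q + 1) → Polynomial ℚ)
    (Cm : Matrix (Fin (q + 1)) (Fin (q + 1) ⊕ Fin (q + 1)) ℚ)
    (τ : Fin (q + 1) → Polynomial ℚ) (π : Fin (q + 1) ⊕ Fin (q + 1) → Polynomial ℚ)
    (f0 : Polynomial ℚ)
    (h : ∀ k l, gosp alp bet (G k l) = τ k * π l - Polynomial.C (Cm k l) * f0) :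
    PiP alp bet q ∣ (Matrix.fromRows (Matrix.of G) (Cm.map Polynomial.C)).det := by
  have hrec : ∀ (x : ℚ) k l, (cub alp).eval x * (G k l).eval (x + 1) =
      (cub bet).eval x * (G k l).eval x + (τ k).eval x * (π l).eval x +
        (- f0.eval x) * Cm k l := by
    intro x k l
    have := congrArg (Polynomial.eval x) (h k l)
    rw [gosp_eval] at this
    simp only [Polynomial.eval_sub, Polynomial.eval_mul, Polynomial.eval_C] at this
    linarith
  have hA : ∀ j (s : ℕ), s < q → (cub alp).eval (bet j + s) ≠ 0 := by
    intro j s hs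
    rw [cub_eval, prod_ne_zero_iff]
    intro i _ h0
    exact hab i j s (by omega) (by linarith)
  have hB : ∀ j (s : ℕ), s < q → (cub bet).eval (alp j - s) ≠ 0 := by
    intro j s hs
    rw [cub_eval, prod_ne_zero_iff]
    intro i _ h0
    exact hab j i s (by omega) (by linarith)
  have hA0 : ∀ i, (cub alp).eval (alp i) = 0 := by
    intro i; rw [cub_eval]; exact prod_eq_zero (mem_univ i) (sub_self _)
  have hB0 : ∀ i, (cub bet).eval (bet i) = 0 := by
    intro i; rw [cub_eval]; exact prod_eq_zero (mem_univ i) (sub_self _)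
  have hrk : ∀ t : Bool × Fin 3 × Fin q,
      RK (fun k l => (G k l).eval (xi alp bet q t)) (fun k l => Cm k l) ((t.2.2 : ℕ) + 1) := by
    rintro ⟨e, i, r⟩
    cases e
    · exact rk_down (fun x k l => (G k l).eval x) (fun k l => Cm k l) (fun x => (cub alp).eval x)
        (fun x => (cub bet).eval x) (fun x => - f0.eval x) (fun x k => (τ k).eval x)
        (fun x l => (π l).eval x) hrec q (alp i) (hA0 i) (hB i) r r.2
    · exact rk_up (fun x k l => (G k l).eval x) (fun k l => Cm k l) (fun x => (cub alp).eval x)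
        (fun x => (cub bet).eval x) (fun x => - f0.eval x) (fun x k => (τ k).eval x)
        (fun x l => (π l).eval x) hrec q (bet i) (hB0 i) (hA i) r r.2
  have hinj : Function.Injective (xi alp bet q) := by
    have hbs : ∀ i i' (r r' : Fin q), bet i + ((r : ℕ) + 1 : ℚ) = bet i' + ((r' : ℕ) + 1 : ℚ) →
        (r : ℕ) ≤ r' → i = i' ∧ r = r' := by
      intro i i' r r' he hle
      have hi : i = i' := by
        by_contra hne
        refine hbb i i' hne (r' - r) (by omega) ?_
        push_cast [hle]; linarith
      subst hi
      refine ⟨rfl, Fin.ext ?_⟩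
      have : ((r : ℕ) : ℚ) = (r' : ℕ) := by linarith
      exact_mod_cast this
    have has : ∀ i i' (r r' : Fin q), alp i - ((r : ℕ) : ℚ) = alp i' - ((r' : ℕ) : ℚ) →
        (r : ℕ) ≤ r' → i = i' ∧ r = r' := by
      intro i i' r r' he hle
      have hi : i = i' := by
        by_contra hne
        refine haa i' i (Ne.symm hne) (r' - r) (by omega) ?_
        push_cast [hle]; linarith
      subst hi
      refine ⟨rfl, Fin.ext ?_⟩
      have : ((r : ℕ) : ℚ) = (r' : ℕ) := by linarith
      exact_mod_cast this
    have hx : ∀ i i' (r r' : Fin q), bet i + ((r : ℕ) + 1 : ℚ) ≠ alp i' - ((r' : ℕ) : ℚ) := by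
      intro i i' r r' he
      refine hab i' i (r + 1 + r') (by omega) ?_
      push_cast; linarith
    rintro ⟨e, i, r⟩ ⟨e', i', r'⟩ he
    cases e <;> cases e' <;> simp only [xi, cond_true, cond_false] at he
    · rcases le_total (r : ℕ) r' with hle | hle
      · obtain ⟨rfl, rfl⟩ := has _ _ _ _ he hle; rfl
      · obtain ⟨rfl, rfl⟩ := has _ _ _ _ he.symm hle; rfl
    · exact absurd he.symm (hx _ _ _ _)
    · exact absurd he (hx _ _ _ _)
    · rcases le_total (r : ℕ) r' with hle | hle
      · obtain ⟨rfl, rfl⟩ := hbs _ _ _ _ he hle; rfl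
      · obtain ⟨rfl, rfl⟩ := hbs _ _ _ _ he.symm hle; rfl
  refine Finset.prod_dvd_of_coprime ?_ ?_
  · intro t _ t' _ hne
    exact (Polynomial.pairwise_coprime_X_sub_C hinj hne).pow
  · intro t _
    obtain ⟨u, v, lam, huv⟩ := hrk t
    have := rank_dvd (Matrix.of G) Cm (xi alp bet q t) ((t.2.2 : ℕ) + 1)
      (by have := t.2.2.2; omega) (Matrix.of fun k s => u s k) (Matrix.of v) lam (by
        intro k l
        rw [Matrix.mul_apply]
        exact huv k l)
    rwa [Nat.add_sub_add_right] at this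

theorem thmX (q M : ℕ) (alp bet : Fin 3 → ℚ) (hsum : ∑ i, bet i - ∑ i, alp i = -3 * q)
    (hab : ∀ i j, ∀ s : ℕ, s ≤ 2 * q → alp i ≠ bet j + s)
    (hbb : ∀ i j, i ≠ j → ∀ s : ℕ, s ≤ q → bet i ≠ bet j + s)
    (haa : ∀ i j, i ≠ j → ∀ s : ℕ, s ≤ q → alp i ≠ alp j + s)
    (i0 : Fin 3) (h0 : ∀ (s : ℕ) (j : Fin 3), alp i0 - s ≠ bet j)
    (W : ℕ → ℚ)
    (hW : ∀ n : ℕ, W (n + 1) * (cub bet).eval ((n : ℚ) + 1) = W n * (cub alp).eval (n : ℚ))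
    (hB0 : (cub bet).eval 0 = 0) (hM : W M = 0)
    (τ : Fin (q + 1) → Polynomial ℚ) (hτ : ∀ k, τ k ∈ Polynomial.degreeLT ℚ (q + 1))
    (π : Fin (q + 1) ⊕ Fin (q + 1) → Polynomial ℚ)
    (hπ : ∀ l, π l ∈ Polynomial.degreeLT ℚ (2 * q + 2)) (m : ℕ) :
    Phi q M W τ π (m + 1) * ∏ i, ∏ r ∈ range (q + 1), ((m : ℚ) - bet i - r) =
      Phi q M W τ π m * ∏ i, ∏ r ∈ range (q + 1), ((m : ℚ) - alp i + r) := by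
  have hd := fun k l => mul_mem_degLT q _ _ (hτ k) (hπ l)
  by_cases hne : ∃ f ∈ Polynomial.degreeLT ℚ (3 * q + 2), Ls W M f ≠ 0
  swap
  · push Not at hne
    have hz : ∀ m, Phi q M W τ π m = 0 := by
      intro m
      refine Matrix.det_eq_zero_of_row_eq_zero (Sum.inr 0) fun l => ?_
      simp only [Matrix.fromRows_apply_inr, Matrix.of_apply]
      exact hne _ (hd _ _)
    rw [hz, hz]; simp
  have hcg : ∀ g, Ls W M (gosp alp bet g) = 0 := by
    intro g; rw [Ls_gosp alp bet W hW hB0, hM]; ring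
  have hsurj := gosp_surj alp bet q hsum i0 h0 (Ls W M) hcg hne
  obtain ⟨f1, hf1, hf1'⟩ := hne
  obtain ⟨f0, hf0, hf0'⟩ : ∃ f0 ∈ Polynomial.degreeLT ℚ (3 * q + 2), Ls W M f0 = 1 :=
    ⟨(Ls W M f1)⁻¹ • f1, Submodule.smul_mem _ _ hf1, by
      rw [map_smul, smul_eq_mul, inv_mul_cancel₀ hf1']⟩
  let Cm : Matrix (Fin (q + 1)) (Fin (q + 1) ⊕ Fin (q + 1)) ℚ :=
    Matrix.of fun k l => Ls W M (τ k * π l)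
  have hg : ∀ k l, ∃ g ∈ Polynomial.degreeLT ℚ (3 * q + 1),
      gosp alp bet g = τ k * π l - Cm k l • f0 := by
    intro k l
    refine hsurj _ (Submodule.sub_mem _ (hd k l) (Submodule.smul_mem _ _ hf0)) ?_
    rw [map_sub, map_smul, hf0']
    simp [Cm]
  choose G hG hGe using hg
  have hdvd := pow_dvd_gam alp bet q hab hbb haa G Cm τ π f0 (fun k l => by
    rw [hGe, Polynomial.smul_eq_C_mul])
  have hdeg := gam_deg q G hG Cm
  set Gam := (Matrix.fromRows (Matrix.of G) (Cm.map Polynomial.C)).det with hGam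
  obtain ⟨e, he⟩ : ∃ e : ℚ, Gam = Polynomial.C e * PiP alp bet q := by
    obtain ⟨e, he⟩ := hdvd
    by_cases hz : e = 0
    · exact ⟨0, by rw [he, hz]; simp⟩
    have hP : (PiP alp bet q) ≠ 0 := by
      rw [PiP, prod_ne_zero_iff]
      exact fun t _ => pow_ne_zero _ (Polynomial.X_sub_C_ne_zero _)
    rw [he, Polynomial.natDegree_mul hP hz, PiP_deg] at hdeg
    have h1 : e.natDegree = 0 := by omega
    obtain ⟨c, hc⟩ := Polynomial.natDegree_eq_zero.mp h1
    exact ⟨c, by rw [he, ← hc, mul_comm]⟩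
  have hPhi : ∀ m : ℕ, Phi q M W τ π m =
      (W m * (cub bet).eval (m : ℚ)) ^ (q + 1) * Gam.eval (m : ℚ) := by
    intro m
    have e1 : Gam.eval (m : ℚ) = (Matrix.fromRows (Matrix.of fun k l => (G k l).eval (m : ℚ)) Cm).det := by
      rw [hGam, ← Polynomial.coe_evalRingHom, RingHom.map_det]
      congr 1
      ext i j
      rcases i with i | i <;> simp
    have e2 : Matrix.fromRows (Matrix.of fun k l => Ls W m (τ k * π l)) Cm =
        Matrix.fromBlocks ((W m * (cub bet).eval (m : ℚ)) • 1) (Ls W m f0 • 1) 0 1 *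
        Matrix.fromRows (Matrix.of fun k l => (G k l).eval (m : ℚ)) Cm := by
      rw [Matrix.fromBlocks_mul_fromRows]
      ext1 i j
      rcases i with i | i
      · have h1 : τ i * π j = gosp alp bet (G i j) + Cm i j • f0 := by rw [hGe]; ring
        simp only [Matrix.fromRows_apply_inl, Matrix.of_apply, Matrix.smul_mul, Matrix.one_mul,
          Matrix.add_apply, Matrix.smul_apply, smul_eq_mul]
        rw [h1, map_add, map_smul, Ls_gosp alp bet W hW hB0, smul_eq_mul]
        ring
      · simp
    show (Matrix.fromRows (Matrix.of fun k l => Ls W m (τ k * π l)) Cm).det = _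
    rw [e2, Matrix.det_mul, Matrix.det_fromBlocks_zero₂₁, e1]
    simp
  rw [hPhi, hPhi, he]
  push_cast
  rw [hW]
  simp only [Polynomial.eval_mul, Polynomial.eval_C]
  have hs := PiP_shift alp bet q m
  rw [mul_pow, mul_pow]
  linear_combination (W m ^ (q + 1) * e) * hs

/-- ballot numbers -/
def bal (e t : ℕ) : ℚ :=
  ((e : ℚ) + 1) * ((e + 2 * t).factorial : ℚ) / ((t.factorial : ℚ) * ((e + 1 + t).factorial : ℚ))

lemma bal_zero (e : ℕ) : bal e 0 = 1 := by
  have : (e.factorial : ℚ) ≠ 0 := by positivity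
  have h2 : (e : ℚ) + 1 ≠ 0 := by positivity
  simp only [bal, mul_zero, add_zero, Nat.factorial_succ, Nat.factorial_zero]
  push_cast
  field_simp

lemma bal_zero_succ (t : ℕ) : bal 0 (t + 1) = bal 1 t := by
  simp only [bal]
  rw [show 0 + 2 * (t + 1) = (1 + 2 * t) + 1 by ring, show 0 + 1 + (t + 1) = 1 + 1 + t by ring,
    Nat.factorial_succ (1 + 2 * t), Nat.factorial_succ t]
  have : (t.factorial : ℚ) ≠ 0 := by positivity
  have : ((1 + 1 + t).factorial : ℚ) ≠ 0 := by positivity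
  have h2 : (t : ℚ) + 1 ≠ 0 := by positivity
  push_cast
  field_simp
  ring

lemma bal_succ_succ (e t : ℕ) : bal (e + 1) (t + 1) = bal e (t + 1) + bal (e + 2) t := by
  simp only [bal]
  rw [show e + 1 + 2 * (t + 1) = (e + 2 * t + 1 + 1) + 1 by ring,
    show e + 2 * (t + 1) = (e + 2 * t + 1) + 1 by ring,
    show e + 2 + 2 * t = (e + 2 * t + 1) + 1 by ring,
    show e + 1 + 1 + (t + 1) = (e + t + 2) + 1 by ring,
    show e + 1 + (t + 1) = e + t + 2 by ring,
    show e + 2 + 1 + t = (e + t + 2) + 1 by ring,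
    Nat.factorial_succ (e + 2 * t + 1 + 1), Nat.factorial_succ t, Nat.factorial_succ (e + t + 2)]
  have : (t.factorial : ℚ) ≠ 0 := by positivity
  have : ((e + t + 2).factorial : ℚ) ≠ 0 := by positivity
  have h2 : (t : ℚ) + 1 ≠ 0 := by positivity
  have h3 : (e : ℚ) + t + 2 + 1 ≠ 0 := by positivity
  push_cast
  field_simp
  ring

lemma lemT (n : ℕ) : ∀ e r : ℕ, 2 * r + e + 1 ≤ n →
    ∑ t ∈ range (r + 1), bal e t * ((n - (e + 1) - 2 * t).choose (r - t) : ℚ) =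
      (n.choose r : ℚ) := by
  induction n with
  | zero => intro e r h; omega
  | succ n ih =>
    intro e r h
    rcases r with _ | r
    · simp [bal_zero]
    rw [Nat.choose_succ_succ]
    push_cast
    rcases e with _ | e
    · rw [sum_range_succ', ← ih 1 r (by omega), bal_zero]
      congr 1
      · refine sum_congr rfl fun t _ => ?_
        rw [bal_zero_succ, show n - 0 - 2 * (t + 1) = n - (1 + 1) - 2 * t by omega,
          show r + 1 - (t + 1) = r - t by omega]
      · simp
    · rw [sum_range_succ', ← ih (e + 2) r (by omega), ← ih e (r + 1) (by omega),
        sum_range_succ' _ (r + 1), bal_zero, bal_zero, ← add_assoc, ← sum_add_distrib]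
      congr 1
      · refine sum_congr rfl fun t _ => ?_
        rw [bal_succ_succ, show r + 1 - (t + 1) = r - t by omega,
          show n - (e + 1) - 2 * (t + 1) = n - (e + 2 + 1) - 2 * t by omega]
        ring

/-- the row polynomial, in the shifted variable -/
def tauF (q k : ℕ) (y : ℚ) : ℚ :=
  (2 * k + 1) * (∏ s ∈ range k, (y - s)) * ∏ s ∈ range (q - k), (y + k + 2 + s)

/-- the weight -/
def ww (q n : ℕ) : ℚ :=
  (∏ s ∈ range n, (4 * (s : ℚ) + 2 - 4 * (q + 1))) /
    (∏ s ∈ range (q + 1), (4 * (s : ℚ) + 2 - 4 * (q + 1))) / (n.factorial : ℚ)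

/-- the row coefficients -/
def al (q k n : ℕ) : ℚ := ww q n * tauF q k (n - (q + 1))

lemma ww_fac_ne (q s : ℕ) : 4 * (s : ℚ) + 2 - 4 * (q + 1) ≠ 0 := by
  intro h
  have : (4 * s + 2 : ℤ) = 4 * (q + 1) := by
    have : (4 * s + 2 : ℚ) = 4 * (q + 1) := by linarith
    exact_mod_cast this
  omega

lemma ww_succ (q n : ℕ) : ww q (n + 1) * (n + 1) = ww q n * (4 * n + 2 - 4 * (q + 1)) := by
  have h : ∏ s ∈ range (q + 1), (4 * (s : ℚ) + 2 - 4 * (q + 1)) ≠ 0 :=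
    prod_ne_zero_iff.mpr fun s _ => ww_fac_ne q s
  have : (n.factorial : ℚ) ≠ 0 := by positivity
  have h2 : (n : ℚ) + 1 ≠ 0 := by positivity
  rw [ww, ww, prod_range_succ _ n, Nat.factorial_succ]
  push_cast
  field_simp

lemma ww_base (q s : ℕ) :
    ww q (q + 1 + s) * (s.factorial : ℚ) * ((q + 1 + s).factorial : ℚ) = ((2 * s).factorial : ℚ) := by
  induction s with
  | zero =>
    have h : ∏ s ∈ range (q + 1), (4 * (s : ℚ) + 2 - 4 * (q + 1)) ≠ 0 :=
      prod_ne_zero_iff.mpr fun s _ => ww_fac_ne q s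
    have : ((q + 1).factorial : ℚ) ≠ 0 := by positivity
    simp only [add_zero, ww, div_self h]
    simp [this]
  | succ s ih =>
    have h := ww_succ q (q + 1 + s)
    rw [← add_assoc, Nat.factorial_succ (q + 1 + s), Nat.factorial_succ s,
      show 2 * (s + 1) = 2 * s + 1 + 1 by ring, Nat.factorial_succ, Nat.factorial_succ (2 * s)]
    push_cast at h ⊢
    rw [← ih]
    linear_combination ((s : ℚ) + 1) * s.factorial * ((q + 1 + s).factorial : ℚ) * h

lemma prod_desc (s k : ℕ) (h : k ≤ s) :
    (∏ u ∈ range k, ((s : ℚ) - u)) * ((s - k).factorial : ℚ) = (s.factorial : ℚ) := by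
  induction k with
  | zero => simp
  | succ k ih =>
    rw [← ih (by omega), prod_range_succ, show s - k = (s - (k + 1)) + 1 by omega,
      Nat.factorial_succ]
    push_cast [h]
    ring

lemma prod_asc (m k : ℕ) :
    (∏ u ∈ range k, ((m : ℚ) + 1 + u)) * (m.factorial : ℚ) = ((m + k).factorial : ℚ) := by
  induction k with
  | zero => simp
  | succ k ih =>
    rw [← add_assoc, Nat.factorial_succ, prod_range_succ]
    push_cast
    rw [← ih]; ring

lemma al_right (q k s : ℕ) (hk : k ≤ q) :
    al q k (q + 1 + s) = if k ≤ s then bal (2 * k) (s - k) else 0 := by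
  have e : ((q + 1 + s : ℕ) : ℚ) - (q + 1) = s := by push_cast; ring
  rw [al, e, tauF]
  split_ifs with h
  · have h1 := prod_desc s k h
    have h2 := prod_asc (s + k + 1) (q - k)
    have h3 := ww_base q s
    rw [show s + k + 1 + (q - k) = q + 1 + s by omega] at h2
    have e2 : ∀ u : ℕ, (s : ℚ) + k + 2 + u = ((s + k + 1 : ℕ) : ℚ) + 1 + u := by
      intro u; push_cast; ring
    simp only [e2]
    set P := ∏ u ∈ range k, ((s : ℚ) - u)
    set R := ∏ u ∈ range (q - k), (((s + k + 1 : ℕ) : ℚ) + 1 + u)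
    rw [bal, show 2 * k + 2 * (s - k) = 2 * s by omega, show 2 * k + 1 + (s - k) = s + k + 1 by omega,
      ← h3, ← h1, ← h2]
    have f1 : ((s - k).factorial : ℚ) ≠ 0 := by positivity
    have f2 : ((s + k + 1).factorial : ℚ) ≠ 0 := by positivity
    push_cast
    field_simp
  · rw [prod_eq_zero (i := s) (by rw [mem_range]; omega) (sub_self _)]
    ring

lemma al_zero (q k : ℕ) (hk : k < q) : al q k 0 = 0 := by
  rw [al, tauF, prod_eq_zero (s := range (q - k)) (i := q - k - 1) (by rw [mem_range]; omega)]
  · ring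
  · rw [Nat.sub_sub, Nat.cast_sub (by omega)]; push_cast; ring

lemma al_rec (q k n : ℕ) (hk : k + 1 < q) :
    al q (k + 1) (n + 1) = al q k n + 2 * al q (k + 1) n + al q (k + 2) n := by
  have hw := ww_succ q n
  have hn : (n : ℚ) + 1 ≠ 0 := by positivity
  have key : (4 * n + 2 - 4 * (q + 1)) * tauF q (k + 1) ((n + 1 : ℕ) - (q + 1)) =
      (n + 1) * (tauF q k (n - (q + 1)) + 2 * tauF q (k + 1) (n - (q + 1)) +
        tauF q (k + 2) (n - (q + 1))) := by
    obtain ⟨m, rfl⟩ : ∃ m, q = k + 2 + m := ⟨q - (k + 2), by omega⟩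
    simp only [tauF]
    rw [show k + 2 + m - (k + 1) = m + 1 by omega, show k + 2 + m - k = m + 1 + 1 by omega,
      show k + 2 + m - (k + 2) = m by omega]
    obtain ⟨y, hy⟩ : ∃ y : ℚ, (n : ℚ) = y + (k + 2 + m + 1) := ⟨n - (k + 2 + m + 1), by ring⟩
    push_cast
    rw [hy]
    have r1 : y + (k + 2 + m + 1) + 1 - ((k : ℚ) + 2 + m + 1) = y + 1 := by ring
    have r2 : y + (k + 2 + m + 1) - ((k : ℚ) + 2 + m + 1) = y := by ring
    rw [r1, r2]
    have p1 : ∏ s ∈ range (k + 1), (y + 1 - s) = (y + 1) * ∏ s ∈ range k, (y - s) := by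
      rw [prod_range_succ', mul_comm]
      congr 1
      · simp
      · refine prod_congr rfl fun s _ => ?_
        push_cast; ring
    have p2 : ∏ s ∈ range (m + 1), (y + 1 + ((k : ℚ) + 1) + 2 + s) =
        (∏ s ∈ range m, (y + ((k : ℚ) + 2) + 2 + s)) * (y + k + 4 + m) := by
      rw [prod_range_succ]
      congr 1
      · refine prod_congr rfl fun s _ => ?_
        ring
      · ring
    have p3 : ∏ s ∈ range (m + 1), (y + ((k : ℚ) + 1) + 2 + s) =
        (∏ s ∈ range m, (y + ((k : ℚ) + 2) + 2 + s)) * (y + k + 3) := by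
      rw [prod_range_succ']
      congr 1
      · refine prod_congr rfl fun s _ => ?_
        push_cast; ring
      · push_cast; ring
    have p4 : ∏ s ∈ range (m + 1 + 1), (y + (k : ℚ) + 2 + s) =
        (∏ s ∈ range m, (y + ((k : ℚ) + 2) + 2 + s)) * (y + k + 3) * (y + k + 2) := by
      rw [prod_range_succ', ← p3]
      congr 1
      · refine prod_congr rfl fun s _ => ?_
        push_cast; ring
      · push_cast; ring
    rw [p1, p2, p3, p4, prod_range_succ _ (k + 1), prod_range_succ _ k]
    push_cast
    ring
  simp only [al]
  apply mul_right_cancel₀ hn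
  linear_combination tauF q (k + 1) ((n + 1 : ℕ) - (q + 1)) * hw + ww q n * key

lemma al_rec0 (q n : ℕ) (hq : 0 < q) :
    al q 0 (n + 1) = al q 0 n + al q 1 n := by
  have hw := ww_succ q n
  have hn : (n : ℚ) + 1 ≠ 0 := by positivity
  have key : (4 * n + 2 - 4 * (q + 1)) * tauF q 0 ((n + 1 : ℕ) - (q + 1)) =
      (n + 1) * (tauF q 0 (n - (q + 1)) + tauF q 1 (n - (q + 1))) := by
    obtain ⟨m, rfl⟩ : ∃ m, q = m + 1 := ⟨q - 1, by omega⟩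
    simp only [tauF]
    rw [show m + 1 - 0 = m + 1 by omega, show m + 1 - 1 = m by omega]
    obtain ⟨y, hy⟩ : ∃ y : ℚ, (n : ℚ) = y + (m + 1 + 1) := ⟨n - (m + 1 + 1), by ring⟩
    push_cast
    rw [hy]
    have r1 : y + (m + 1 + 1) + 1 - ((m : ℚ) + 1 + 1) = y + 1 := by ring
    have r2 : y + (m + 1 + 1) - ((m : ℚ) + 1 + 1) = y := by ring
    rw [r1, r2]
    have p2 : ∏ s ∈ range (m + 1), (y + 1 + 0 + 2 + (s : ℚ)) =
        (∏ s ∈ range m, (y + 1 + 2 + (s : ℚ))) * (y + 3 + m) := by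
      rw [prod_range_succ]
      congr 1
      · refine prod_congr rfl fun s _ => ?_
        ring
      · ring
    have p3 : ∏ s ∈ range (m + 1), (y + 0 + 2 + (s : ℚ)) =
        (∏ s ∈ range m, (y + 1 + 2 + (s : ℚ))) * (y + 2) := by
      rw [prod_range_succ']
      congr 1
      · refine prod_congr rfl fun s _ => ?_
        push_cast; ring
      · push_cast; ring
    rw [p2, p3, prod_range_one, prod_range_zero]
    push_cast
    ring
  simp only [al]
  apply mul_right_cancel₀ hn
  linear_combination tauF q 0 ((n + 1 : ℕ) - (q + 1)) * hw + ww q n * key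

lemma al_left0 (q n : ℕ) (hn : n ≤ q) : al q 0 n = if n = q then -1 / 2 else 0 := by
  split_ifs with h
  · subst h
    have hw := ww_succ n n
    have hb := ww_base n 0
    have ha := prod_asc 0 n
    have e : (n : ℚ) - (n + 1) = -1 := by ring
    rw [al, tauF, e, Nat.sub_zero]
    simp only [Nat.factorial_zero, mul_zero, add_zero, Nat.cast_one, mul_one, Nat.cast_zero,
      zero_add, prod_range_zero] at *
    have e2 : ∏ s ∈ range n, (-1 + 2 + (s : ℚ)) = (n.factorial : ℚ) := by
      rw [← ha]
      refine prod_congr rfl fun s _ => ?_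
      ring
    rw [e2]
    rw [Nat.factorial_succ] at hb
    push_cast at hb
    linear_combination (-1 / 2 : ℚ) * hb + (1 / 2 : ℚ) * n.factorial * hw
  · rw [al, tauF, prod_eq_zero (s := range (q - 0)) (i := q - 1 - n) (by rw [mem_range]; omega)]
    · ring
    · rw [Nat.sub_sub, Nat.cast_sub (by omega)]; push_cast; ring

lemma ibinom_nat (n k : ℕ) : ibinom n k = (n.choose k : ℚ) := by
  unfold ibinom
  split_ifs with h
  · simp
  · rw [Nat.choose_eq_zero_of_lt (by omega)]; simp

lemma ibinom_neg (n k : ℤ) (h : k < 0) : ibinom n k = 0 := by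
  unfold ibinom
  rw [if_neg (by omega)]

lemma ibinom_pascal (n k : ℤ) (hn : 0 ≤ n) : ibinom (n + 1) k = ibinom n k + ibinom n (k - 1) := by
  rcases lt_trichotomy k 0 with h | h | h
  · rw [ibinom_neg _ _ h, ibinom_neg _ _ h, ibinom_neg _ _ (by omega)]; simp
  · subst h
    rw [ibinom_neg _ (0 - 1) (by omega)]
    unfold ibinom
    simp [hn, (by omega : 0 ≤ n + 1)]
  · obtain ⟨n, rfl⟩ := Int.eq_ofNat_of_zero_le hn
    obtain ⟨m, hm⟩ := Int.eq_ofNat_of_zero_le (by omega : 0 ≤ k - 1)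
    obtain rfl : k = ((m + 1 : ℕ) : ℤ) := by push_cast; omega
    rw [hm, show (n : ℤ) + 1 = ((n + 1 : ℕ) : ℤ) by push_cast; ring, ibinom_nat, ibinom_nat,
      ibinom_nat, Nat.choose_succ_succ]
    push_cast; ring

lemma sum_window (f : ℕ → ℚ) (k r d : ℕ) (hd : k + r < d) (h1 : ∀ s, s < k → f s = 0)
    (h2 : ∀ s, k + r < s → f s = 0) :
    ∑ s ∈ range d, f s = ∑ t ∈ range (r + 1), f (k + t) := by
  have h := Finset.sum_Ico_eq_sum_range f k (k + r + 1)
  rw [show k + r + 1 - k = r + 1 by omega] at h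
  rw [← h]
  symm
  refine sum_subset ?_ ?_
  · intro s hs
    rw [mem_Ico] at hs
    rw [mem_range]; omega
  · intro s _ hs
    rw [mem_Ico, not_and_or] at hs
    rcases hs with hs | hs
    · exact h1 s (by omega)
    · exact h2 s (by omega)

lemma ida (q k j d : ℕ) (hk : k ≤ q) (hj : j < d) :
    ∑ s ∈ range d, al q k (q + 1 + s) * ibinom (2 * ((j : ℤ) - s)) ((j : ℤ) - s) =
      ibinom (2 * j + 1) ((j : ℤ) - k) := by
  rcases le_or_gt k j with h | h
  · rw [sum_window _ k (j - k) d (by omega)]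
    · have hT := lemT (2 * j + 1) (2 * k) (j - k) (by omega)
      rw [show (j : ℤ) - k = ((j - k : ℕ) : ℤ) by omega,
        show 2 * (j : ℤ) + 1 = ((2 * j + 1 : ℕ) : ℤ) by push_cast; ring, ibinom_nat, ← hT]
      refine sum_congr rfl fun t ht => ?_
      rw [mem_range] at ht
      rw [al_right q k _ hk, if_pos (by omega), Nat.add_sub_cancel_left,
        show (j : ℤ) - (k + t : ℕ) = ((j - k - t : ℕ) : ℤ) by omega,
        show 2 * ((j - k - t : ℕ) : ℤ) = ((2 * j + 1 - (2 * k + 1) - 2 * t : ℕ) : ℤ) by omega,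
        ibinom_nat]
    · intro s hs
      rw [al_right q k _ hk, if_neg (by omega), zero_mul]
    · intro s hs
      rw [ibinom_neg _ _ (by omega), mul_zero]
  · rw [ibinom_neg _ ((j : ℤ) - k) (by omega)]
    refine sum_eq_zero fun s _ => ?_
    rcases le_or_gt k s with h' | h'
    · rw [ibinom_neg _ _ (by omega), mul_zero]
    · rw [al_right q k _ hk, if_neg (by omega), zero_mul]

lemma ida' (j k : ℕ) :
    ibinom (2 * j + 1) ((j : ℤ) + 1 + k) = ibinom (2 * j + 1) ((j : ℤ) - k) := by
  rcases le_or_gt k j with h | h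
  · rw [show (j : ℤ) - k = ((j - k : ℕ) : ℤ) by omega,
      show (j : ℤ) + 1 + k = ((j + 1 + k : ℕ) : ℤ) by omega,
      show 2 * (j : ℤ) + 1 = ((2 * j + 1 : ℕ) : ℤ) by push_cast; ring, ibinom_nat, ibinom_nat,
      Nat.choose_symm_of_eq_add (show 2 * j + 1 = (j + 1 + k) + (j - k) by omega)]
  · rw [ibinom_neg _ ((j : ℤ) - k) (by omega), ibinom, if_neg (by omega)]

lemma idb (q k b c j : ℕ) (hk : k ≤ q) (hj : j < 2 * q + 2) (hb : c + 2 * q + 1 ≤ b) :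
    ∑ s ∈ range (c + q + 1), al q k (q + 1 + s) *
        ibinom ((b : ℤ) + c - 1 - 2 * s) ((c : ℤ) + j - (q + 1) - s) =
      ibinom ((b : ℤ) + c) ((c : ℤ) + j - (q + 1) - k) := by
  rcases le_or_gt (q + 1 + k) (c + j) with h | h
  · rw [sum_window _ k (c + j - (q + 1 + k)) _ (by omega)]
    · have hT := lemT (b + c) (2 * k) (c + j - (q + 1 + k)) (by omega)
      rw [show (c : ℤ) + j - (q + 1) - k = ((c + j - (q + 1 + k) : ℕ) : ℤ) by omega,
        show (b : ℤ) + c = ((b + c : ℕ) : ℤ) by push_cast; ring, ibinom_nat, ← hT]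
      refine sum_congr rfl fun t ht => ?_
      rw [mem_range] at ht
      rw [al_right q k _ hk, if_pos (by omega), Nat.add_sub_cancel_left,
        show (c : ℤ) + j - (q + 1) - (k + t : ℕ) = ((c + j - (q + 1 + k) - t : ℕ) : ℤ) by omega,
        show ((b + c : ℕ) : ℤ) - 1 - 2 * (k + t : ℕ) =
          ((b + c - (2 * k + 1) - 2 * t : ℕ) : ℤ) by omega,
        ibinom_nat]
    · intro s hs
      rw [al_right q k _ hk, if_neg (by omega), zero_mul]
    · intro s hs
      rw [ibinom_neg _ _ (by omega), mul_zero]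
  · rw [ibinom_neg _ ((c : ℤ) + j - (q + 1) - k) (by omega)]
    refine sum_eq_zero fun s _ => ?_
    rcases le_or_gt k s with h' | h'
    · rw [ibinom_neg _ _ (by omega), mul_zero]
    · rw [al_right q k _ hk, if_neg (by omega), zero_mul]

/-- left partial sums -/
def YY (q k : ℕ) (N r : ℤ) : ℚ :=
  -2 * ∑ n ∈ range (q + 1), al q k n * ibinom (N + 2 * ((q : ℤ) + 1 - n) - 1) (r + q - n)

lemma YY_shift (q k : ℕ) (hk : k < q) (N r : ℤ) : YY q k (N + 2) (r + 1) =
    -2 * (∑ n ∈ range (q + 1), al q k (n + 1) *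
      ibinom (N + 2 * ((q : ℤ) + 1 - n) - 1) (r + q - n) - al q k (q + 1) * ibinom (N + 1) r) := by
  rw [YY, sum_range_succ', al_zero q k hk, sum_range_succ _ q, zero_mul, add_zero]
  congr 1
  have : (N + 2 * ((q : ℤ) + 1 - q) - 1) = N + 1 := by ring
  rw [this, show r + (q : ℤ) - q = r by ring, add_sub_cancel_right]
  refine sum_congr rfl fun n _ => ?_
  push_cast
  congr 2 <;> ring

lemma YY_zero (q : ℕ) (N r : ℤ) : YY q 0 N r = ibinom (N + 1) r := by
  rw [YY, sum_range_succ, sum_eq_zero, al_left0 q q le_rfl, if_pos rfl,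
    show (N + 2 * ((q : ℤ) + 1 - q) - 1) = N + 1 by ring, show r + (q : ℤ) - q = r by ring]
  · ring
  · intro n hn
    rw [mem_range] at hn
    rw [al_left0 q n (by omega), if_neg (by omega), zero_mul]

lemma idc (q : ℕ) (k : ℕ) : k ≤ q → ∀ N r : ℤ, 0 ≤ N →
    YY q k N r = ibinom N (r + k) + ibinom N (r - 1 - k) := by
  induction k using Nat.strong_induction_on with
  | _ k ih =>
    intro hk N r hN
    have hp2 : ∀ s : ℤ, ibinom (N + 2) s = ibinom N s + 2 * ibinom N (s - 1) + ibinom N (s - 2) := by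
      intro s
      rw [show N + 2 = N + 1 + 1 by ring, ibinom_pascal _ _ (by omega), ibinom_pascal _ _ hN,
        ibinom_pascal _ _ hN, show s - 1 - 1 = s - 2 by ring]
      ring
    rcases k with _ | _ | k
    · rw [YY_zero, ibinom_pascal _ _ hN]; simp
    · have h0 := YY_shift q 0 (by omega) N r
      rw [YY_zero] at h0
      have e : ∑ n ∈ range (q + 1), al q 0 (n + 1) *
          ibinom (N + 2 * ((q : ℤ) + 1 - n) - 1) (r + q - n) =
          - 1 / 2 * (YY q 0 N r + YY q 1 N r) := by
        rw [YY, YY, ← mul_add, ← sum_add_distrib, ← mul_assoc]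
        norm_num
        refine sum_congr rfl fun n _ => ?_
        rw [al_rec0 q n (by omega)]; ring
      have h1 := al_right q 0 0 (by omega)
      rw [if_pos le_rfl, Nat.sub_self, mul_zero, bal_zero, add_zero] at h1
      rw [e, h1, YY_zero, ibinom_pascal (N + 2) _ (by omega), hp2, hp2, ibinom_pascal _ _ hN] at h0
      push_cast
      rw [show r + 1 - 1 = r by ring, show r + 1 - 2 = r - 1 by ring] at h0
      rw [show r - 1 - 1 = r - 2 by ring]
      linarith
    · have h0 := YY_shift q (k + 1) (by omega) N r
      have e : ∑ n ∈ range (q + 1), al q (k + 1) (n + 1) *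
          ibinom (N + 2 * ((q : ℤ) + 1 - n) - 1) (r + q - n) =
          - 1 / 2 * (YY q k N r + 2 * YY q (k + 1) N r + YY q (k + 2) N r) := by
        have : YY q k N r + 2 * YY q (k + 1) N r + YY q (k + 2) N r =
          -2 * (∑ n ∈ range (q + 1), (al q k n + 2 * al q (k + 1) n + al q (k + 2) n) *
            ibinom (N + 2 * ((q : ℤ) + 1 - n) - 1) (r + q - n)) := by
          simp only [YY, add_mul, sum_add_distrib, mul_assoc, ← mul_sum]
          ring
        rw [this, ← mul_assoc]
        norm_num
        refine sum_congr rfl fun n _ => ?_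
        rw [al_rec q k n (by omega)]
      have h1 := al_right q (k + 1) 0 (by omega)
      rw [if_neg (by omega), add_zero] at h1
      rw [e, h1, ih (k + 1) (by omega) (by omega) _ _ (by omega),
        ih (k + 1) (by omega) (by omega) _ _ hN, ih k (by omega) (by omega) _ _ hN,
        hp2, hp2] at h0
      push_cast at h0 ⊢
      rw [show r + 1 + ((k : ℤ) + 1) = r + (k + 1 + 1) by ring,
        show r + ((k : ℤ) + 1 + 1) - 1 = r + (k + 1) by ring,
        show r + ((k : ℤ) + 1 + 1) - 2 = r + k by ring,
        show r + 1 - 1 - ((k : ℤ) + 1) = r - 1 - k by ring,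
        show r - 1 - (k : ℤ) - 1 = r - 1 - (k + 1) by ring,
        show r - 1 - (k : ℤ) - 2 = r - 1 - (k + 1 + 1) by ring] at h0
      linarith

lemma poch_prod (x : ℚ) (n : ℕ) : poch x n = ∏ r ∈ range n, (x + r) := by
  induction n with
  | zero => simp [poch]
  | succ n ih =>
    rw [prod_range_succ, ← ih, poch, poch, ascPochhammer_succ_eval]

/-- the row polynomials -/
def tauP (q k : ℕ) : Polynomial ℚ :=
  Polynomial.C (2 * (k : ℚ) + 1) *
    (∏ s ∈ range k, (Polynomial.X - Polynomial.C ((q : ℚ) + 1 + s))) *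
    ∏ s ∈ range (q - k), (Polynomial.X - Polynomial.C ((q : ℚ) + 1 - (k + 2 + s)))

/-- the column polynomials -/
def piP (q b c j : ℕ) : Polynomial ℚ :=
  (∏ u ∈ range (2 * q + 1 - j), (Polynomial.C ((c : ℚ) + 2 * q + 1 - u) - Polynomial.X)) *
    ∏ u ∈ range j, (Polynomial.C ((b : ℚ) + 2 * q + 1 - u) - Polynomial.X)

/-- second part of the weight -/
def vv (q b c n : ℕ) : ℚ :=
  ((b + c + 2 * q + 1 - 2 * n).factorial : ℚ) /
    (((c + 2 * q + 1 - n).factorial : ℚ) * ((b + 2 * q + 1 - n).factorial : ℚ))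

/-- full weight -/
def WW (q b c n : ℕ) : ℚ := if n < c + 2 * q + 2 then ww q n * vv q b c n else 0

lemma tauP_eval (q k n : ℕ) : (tauP q k).eval (n : ℚ) = tauF q k (n - (q + 1)) := by
  rw [tauP, tauF]
  simp only [Polynomial.eval_mul, Polynomial.eval_C, Polynomial.eval_prod, Polynomial.eval_sub,
    Polynomial.eval_X]
  congr 1
  · congr 1
    refine prod_congr rfl fun s _ => ?_
    ring
  · refine prod_congr rfl fun s _ => ?_
    ring

open Polynomial in
lemma mem_degLT_of_natDegree (f : ℚ[X]) (n : ℕ) (h : f.natDegree < n) : f ∈ degreeLT ℚ n := by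
  rw [mem_degreeLT]
  exact lt_of_le_of_lt degree_le_natDegree (by exact_mod_cast h)

open Polynomial in
lemma natDegree_prod_lin (n : ℕ) (f : ℕ → ℚ[X]) (h : ∀ s, (f s).natDegree ≤ 1) :
    (∏ s ∈ range n, f s).natDegree ≤ n := by
  refine (natDegree_prod_le _ _).trans ?_
  refine (sum_le_sum fun s _ => h s).trans ?_
  simp

open Polynomial in
lemma tauP_mem (q k : ℕ) (hk : k ≤ q) : tauP q k ∈ degreeLT ℚ (q + 1) := by
  apply mem_degLT_of_natDegree
  have h1 := natDegree_prod_lin k (fun s => X - C ((q : ℚ) + 1 + s))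
    (fun s => (natDegree_X_sub_C _).le)
  have h2 := natDegree_prod_lin (q - k) (fun s => X - C ((q : ℚ) + 1 - (k + 2 + s)))
    (fun s => (natDegree_X_sub_C _).le)
  have h3 := natDegree_mul_le (p := C (2 * (k : ℚ) + 1) *
    (∏ s ∈ range k, (X - C ((q : ℚ) + 1 + s))))
    (q := ∏ s ∈ range (q - k), (X - C ((q : ℚ) + 1 - (k + 2 + s))))
  have h4 := natDegree_C_mul_le (2 * (k : ℚ) + 1) (∏ s ∈ range k, (X - C ((q : ℚ) + 1 + s)))
  rw [tauP]
  omega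

open Polynomial in
lemma piP_mem (q b c j : ℕ) (hj : j ≤ 2 * q + 1) : piP q b c j ∈ degreeLT ℚ (2 * q + 2) := by
  apply mem_degLT_of_natDegree
  have h0 : ∀ x : ℚ, (C x - X).natDegree ≤ 1 := by
    intro x; compute_degree
  have h1 := natDegree_prod_lin (2 * q + 1 - j) (fun u => C ((c : ℚ) + 2 * q + 1 - u) - X)
    (fun s => h0 _)
  have h2 := natDegree_prod_lin j (fun u => C ((b : ℚ) + 2 * q + 1 - u) - X)
    (fun s => h0 _)
  have h3 := natDegree_mul_le (p := ∏ u ∈ range (2 * q + 1 - j), (C ((c : ℚ) + 2 * q + 1 - u) - X))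
    (q := ∏ u ∈ range j, (C ((b : ℚ) + 2 * q + 1 - u) - X))
  rw [piP]
  omega

lemma vv_pi (q b c j n : ℕ) (hb : c + 4 * q + 10 ≤ b) (hj : j ≤ 2 * q + 1)
    (hn : n < c + 2 * q + 2) : vv q b c n * (piP q b c j).eval (n : ℚ) =
      ibinom ((b : ℤ) + c + 2 * q + 1 - 2 * n) ((c : ℤ) + j - n) := by
  rw [piP]
  simp only [Polynomial.eval_mul, Polynomial.eval_C, Polynomial.eval_prod, Polynomial.eval_sub,
    Polynomial.eval_X]
  have e1 : ∏ u ∈ range (2 * q + 1 - j), ((c : ℚ) + 2 * q + 1 - u - n) =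
      ∏ u ∈ range (2 * q + 1 - j), (((c + 2 * q + 1 - n : ℕ) : ℚ) - u) := by
    refine prod_congr rfl fun u _ => ?_
    rw [Nat.cast_sub (by omega)]; push_cast; ring
  have e2 : ∏ u ∈ range j, ((b : ℚ) + 2 * q + 1 - u - n) =
      ∏ u ∈ range j, (((b + 2 * q + 1 - n : ℕ) : ℚ) - u) := by
    refine prod_congr rfl fun u _ => ?_
    rw [Nat.cast_sub (by omega)]; push_cast; ring
  rw [e1, e2]
  rcases le_or_gt n (c + j) with h | h
  · have h1 := prod_desc (c + 2 * q + 1 - n) (2 * q + 1 - j) (by omega)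
    have h2 := prod_desc (b + 2 * q + 1 - n) j (by omega)
    rw [show (c : ℤ) + j - n = ((c + j - n : ℕ) : ℤ) by omega,
      show (b : ℤ) + c + 2 * q + 1 - 2 * n = ((b + c + 2 * q + 1 - 2 * n : ℕ) : ℤ) by omega,
      ibinom_nat, Nat.cast_choose ℚ (by omega), vv, ← h1, ← h2,
      show c + 2 * q + 1 - n - (2 * q + 1 - j) = c + j - n by omega,
      show b + c + 2 * q + 1 - 2 * n - (c + j - n) = b + 2 * q + 1 - n - j by omega]
    have f1 : ∏ u ∈ range (2 * q + 1 - j), (((c + 2 * q + 1 - n : ℕ) : ℚ) - u) ≠ 0 := by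
      intro h0; rw [h0, zero_mul] at h1
      exact absurd h1.symm (by positivity)
    have f2 : ∏ u ∈ range j, (((b + 2 * q + 1 - n : ℕ) : ℚ) - u) ≠ 0 := by
      intro h0; rw [h0, zero_mul] at h2
      exact absurd h2.symm (by positivity)
    have f3 : ((c + j - n).factorial : ℚ) ≠ 0 := by positivity
    have f4 : ((b + 2 * q + 1 - n - j).factorial : ℚ) ≠ 0 := by positivity
    field_simp
  · rw [ibinom_neg _ _ (by omega), prod_eq_zero (s := range (2 * q + 1 - j))
      (i := c + 2 * q + 1 - n) (by rw [mem_range]; omega) (sub_self _)]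
    ring

lemma Ls_al (q b c k j m : ℕ) (hb : c + 4 * q + 10 ≤ b) (hj : j ≤ 2 * q + 1)
    (hm : m ≤ c + 2 * q + 2) : Ls (WW q b c) m (tauP q k * piP q b c j) =
      ∑ n ∈ range m, al q k n * ibinom ((b : ℤ) + c + 2 * q + 1 - 2 * n) ((c : ℤ) + j - n) := by
  rw [Ls_apply]
  refine sum_congr rfl fun n hn => ?_
  rw [mem_range] at hn
  rw [← vv_pi q b c j n hb hj (by omega), WW, if_pos (by omega), Polynomial.eval_mul, tauP_eval, al]
  ring

/-- numerator roots -/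
def alpV (q b c : ℕ) : Fin 3 → ℚ := ![(c : ℚ) + 2 * q + 1, (b : ℚ) + 2 * q + 1, (q : ℚ) + 1 / 2]
/-- denominator roots -/
def betV (q b c : ℕ) : Fin 3 → ℚ :=
  ![0, ((b : ℚ) + c) / 2 + q + 1, ((b : ℚ) + c) / 2 + q + 3 / 2]

lemma WW_rec (q b c : ℕ) (hb : c + 4 * q + 10 ≤ b) (n : ℕ) :
    WW q b c (n + 1) * (cub (betV q b c)).eval ((n : ℚ) + 1) =
      WW q b c n * (cub (alpV q b c)).eval (n : ℚ) := by
  rw [cub_eval, cub_eval, Fin.prod_univ_three, Fin.prod_univ_three]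
  simp only [alpV, betV, Matrix.cons_val_zero, Matrix.cons_val_one, Matrix.cons_val]
  rcases lt_trichotomy n (c + 2 * q + 1) with h | h | h
  · have hw := ww_succ q n
    rw [WW, WW, if_pos (by omega), if_pos (by omega)]
    have hv : vv q b c (n + 1) * (((b : ℚ) + c + 2 * q + 1 - 2 * n) * ((b : ℚ) + c + 2 * q - 2 * n)) =
        vv q b c n * (((c : ℚ) + 2 * q + 1 - n) * ((b : ℚ) + 2 * q + 1 - n)) := by
      obtain ⟨x, hx⟩ : ∃ x, c + 2 * q + 1 = n + x + 1 := ⟨c + 2 * q - n, by omega⟩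
      obtain ⟨y, hy⟩ : ∃ y, b + 2 * q + 1 = n + y + 1 := ⟨b + 2 * q - n, by omega⟩
      obtain ⟨z, hz⟩ : ∃ z, b + c + 2 * q + 1 = 2 * n + z + 2 := ⟨b + c + 2 * q - 1 - 2 * n, by omega⟩
      simp only [vv]
      have hx' : (c : ℚ) + 2 * q + 1 = n + x + 1 := by exact_mod_cast hx
      have hy' : (b : ℚ) + 2 * q + 1 = n + y + 1 := by exact_mod_cast hy
      have hz' : (b : ℚ) + c + 2 * q + 1 = 2 * n + z + 2 := by exact_mod_cast hz
      have hz2 : (b : ℚ) + c + 2 * q = 2 * n + z + 1 := by linarith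
      rw [hx', hy', hz', hz2, hx, hy, hz, show 2 * n + z + 2 - 2 * (n + 1) = z by omega,
        show 2 * n + z + 2 - 2 * n = z + 1 + 1 by omega, show n + x + 1 - (n + 1) = x by omega,
        show n + x + 1 - n = x + 1 by omega, show n + y + 1 - (n + 1) = y by omega,
        show n + y + 1 - n = y + 1 by omega]
      simp only [Nat.factorial_succ]
      have f3 : (x.factorial : ℚ) ≠ 0 := by positivity
      have f4 : (y.factorial : ℚ) ≠ 0 := by positivity
      have f5 : (x : ℚ) + 1 ≠ 0 := by positivity
      have f6 : (y : ℚ) + 1 ≠ 0 := by positivity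
      push_cast
      field_simp
      ring
    linear_combination (1 / 4 * vv q b c (n + 1) * (((b : ℚ) + c + 2 * q + 1 - 2 * n) *
      ((b : ℚ) + c + 2 * q - 2 * n))) * hw + (ww q n * (n - (q + 1 / 2))) * hv
  · rw [WW, if_neg (by omega), h]
    push_cast; ring
  · rw [WW, WW, if_neg (by omega), if_neg (by omega)]; ring

/-- row index map -/
def kap (q i : ℕ) : ℕ := if i ≤ q then q - i else i - (q + 1)

/-- reduced matrix entries -/
def RR (q b c d i j : ℕ) : ℚ :=
  ibinom ((b : ℤ) + c) ((c : ℤ) - i + j) - ∑ s ∈ range d, al q (kap q i) (q + 1 + s) *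
    ibinom ((b : ℤ) + c - 1 - 2 * s) ((c : ℤ) + j - (q + 1) - s)

/-- determinant of the reduced matrix -/
def DR (q b c d : ℕ) : ℚ :=
  (Matrix.of fun i j : Fin (2 * (q + 1)) => RR q b c d i j).det

/-- the reindexing -/
def eqv (q : ℕ) : Fin (q + 1) ⊕ Fin (q + 1) ≃ Fin (2 * (q + 1)) :=
  (Equiv.sumCongr Fin.revPerm (Equiv.refl _)).trans
    (finSumFinEquiv.trans (finCongr (by ring)))

lemma eqv_inl (q : ℕ) (k : Fin (q + 1)) : ((eqv q (Sum.inl k) : Fin _) : ℕ) = q - k := by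
  simp [eqv, Fin.val_rev]

lemma eqv_inr (q : ℕ) (k : Fin (q + 1)) : ((eqv q (Sum.inr k) : Fin _) : ℕ) = q + 1 + k := by
  simp [eqv, add_comm]

lemma DR_eq (q b c d : ℕ) (hb : c + 4 * q + 10 ≤ b) (hd : d ≤ c) :
    DR q b c d = (-2) ^ (q + 1) * Phi q (c + 2 * q + 2) (WW q b c) (fun k => tauP q k)
      (fun l => piP q b c (eqv q l)) (q + 1 + d) := by
  rw [DR, ← Matrix.det_submatrix_equiv_self (eqv q), Phi]
  set L := (Matrix.of fun (k : Fin (q + 1)) (l : Fin (q + 1) ⊕ Fin (q + 1)) =>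
    Ls (WW q b c) (q + 1 + d) (tauP q k * piP q b c (eqv q l))) with hL
  set C := (Matrix.of fun (k : Fin (q + 1)) (l : Fin (q + 1) ⊕ Fin (q + 1)) =>
    Ls (WW q b c) (c + 2 * q + 2) (tauP q k * piP q b c (eqv q l))) with hC
  have key : (Matrix.of fun i j : Fin (2 * (q + 1)) => RR q b c d i j).submatrix (eqv q) (eqv q) =
      Matrix.fromBlocks (-1) (-1) (-1) 1 * Matrix.fromRows L C := by
    rw [Matrix.fromBlocks_mul_fromRows]
    ext1 i l
    have hj : ((eqv q l : Fin _) : ℕ) ≤ 2 * q + 1 := by have := (eqv q l).2; omega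
    have hLs : ∀ k m : ℕ, m ≤ c + q + 1 →
        Ls (WW q b c) (q + 1 + m) (tauP q k * piP q b c (eqv q l)) =
        -1 / 2 * YY q k ((b : ℤ) + c) ((c : ℤ) + (eqv q l : ℕ) - q) +
        ∑ s ∈ range m, al q k (q + 1 + s) *
          ibinom ((b : ℤ) + c - 1 - 2 * s) ((c : ℤ) + (eqv q l : ℕ) - (q + 1) - s) := by
      intro k m hm
      rw [Ls_al q b c k _ _ hb hj (by omega), sum_range_add, YY, ← mul_assoc]
      norm_num
      congr 1
      · refine sum_congr rfl fun n _ => ?_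
        congr 2 <;> ring
      · refine sum_congr rfl fun n _ => ?_
        congr 2 <;> ring
    have hLL : ∀ k : Fin (q + 1), L k l = _ := fun k => hLs k d (by omega)
    have hCC : ∀ k : Fin (q + 1), C k l = -1 / 2 * YY q k ((b : ℤ) + c) ((c : ℤ) + (eqv q l : ℕ) - q) +
        ibinom ((b : ℤ) + c) ((c : ℤ) + (eqv q l : ℕ) - (q + 1) - k) := fun k => by
      have := hLs k (c + q + 1) le_rfl
      rw [show q + 1 + (c + q + 1) = c + 2 * q + 2 by ring,
        idb q k b c _ (by omega) (by omega) (by omega)] at this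
      exact this
    rcases i with k | k
    · have hc := idc q k (by omega) ((b : ℤ) + c) ((c : ℤ) + (eqv q l : ℕ) - q) (by omega)
      simp only [Matrix.submatrix_apply, Matrix.of_apply, Matrix.fromRows_apply_inl,
        Matrix.add_apply, Matrix.neg_mul, Matrix.one_mul, Matrix.neg_apply]
      rw [hLL, hCC, RR, eqv_inl, kap, if_pos (by omega), show q - (q - (k : ℕ)) = k by omega, hc,
        show (c : ℤ) - ((q - (k : ℕ) : ℕ) : ℤ) + (eqv q l : ℕ) = (c : ℤ) + (eqv q l : ℕ) - q + k by omega,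
        show (c : ℤ) + (eqv q l : ℕ) - q - 1 - k = (c : ℤ) + (eqv q l : ℕ) - (q + 1) - k by ring]
      ring
    · simp only [Matrix.submatrix_apply, Matrix.of_apply, Matrix.fromRows_apply_inr,
        Matrix.add_apply, Matrix.neg_mul, Matrix.one_mul, Matrix.neg_apply]
      rw [hLL, hCC, RR, eqv_inr, kap, if_neg (by omega), show q + 1 + (k : ℕ) - (q + 1) = k by omega,
        show (c : ℤ) - ((q + 1 + (k : ℕ) : ℕ) : ℤ) + (eqv q l : ℕ) =
          (c : ℤ) + (eqv q l : ℕ) - (q + 1) - k by push_cast; ring]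
      ring
  rw [key, Matrix.det_mul, Matrix.det_fromBlocks_one₂₂]
  congr 1
  have : (-1 - -1 * -1 : Matrix (Fin (q + 1)) (Fin (q + 1)) ℚ) = (-2 : ℚ) • 1 := by
    ext i j
    by_cases h : i = j
    · subst h; simp; norm_num
    · simp [h]
  rw [this, Matrix.det_smul]
  simp

lemma half_ne (q s : ℕ) : (q : ℚ) + 1 / 2 ≠ s := by
  intro h
  have : (2 * q + 1 : ℚ) = 2 * s := by linarith
  have : 2 * q + 1 = 2 * s := by exact_mod_cast this
  omega

lemma Phi_step (q b c m : ℕ) (hb : c + 4 * q + 10 ≤ b) :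
    Phi q (c + 2 * q + 2) (WW q b c) (fun k => tauP q k)
      (fun l => piP q b c (eqv q l)) (m + 1) *
        ∏ i, ∏ r ∈ range (q + 1), ((m : ℚ) - betV q b c i - r) =
      Phi q (c + 2 * q + 2) (WW q b c) (fun k => tauP q k)
      (fun l => piP q b c (eqv q l)) m *
        ∏ i, ∏ r ∈ range (q + 1), ((m : ℚ) - alpV q b c i + r) := by
  have hb' : (c : ℚ) + 4 * q + 10 ≤ b := by exact_mod_cast hb
  have hc0 : (0 : ℚ) ≤ c := by positivity
  have hq0 : (0 : ℚ) ≤ q := by positivity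
  refine thmX q (c + 2 * q + 2) (alpV q b c) (betV q b c) ?_ ?_ ?_ ?_ 2 ?_ (WW q b c)
    (WW_rec q b c hb) ?_ ?_ _ ?_ _ ?_ m
  · simp only [alpV, betV, Fin.sum_univ_three, Matrix.cons_val_zero, Matrix.cons_val_one,
      Matrix.cons_val]
    ring
  · intro i j s hs
    have hs' : (s : ℚ) ≤ 2 * q := by exact_mod_cast hs
    have hs0 : (0 : ℚ) ≤ s := by positivity
    have hh := half_ne q s
    fin_cases i <;> fin_cases j <;> simp [alpV, betV] <;> intro h <;>
      first | linarith | (apply hh; linarith)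
  · intro i j hij s hs
    have hs' : (s : ℚ) ≤ q := by exact_mod_cast hs
    have hs0 : (0 : ℚ) ≤ s := by positivity
    have hh := half_ne 0 s
    fin_cases i <;> fin_cases j <;> simp [alpV, betV] at hij hh ⊢ <;> intro h <;>
      first | linarith | (apply hh; linarith)
  · intro i j hij s hs
    have hs' : (s : ℚ) ≤ q := by exact_mod_cast hs
    have hs0 : (0 : ℚ) ≤ s := by positivity
    fin_cases i <;> fin_cases j <;> simp [alpV, betV] at hij ⊢ <;> intro h <;> linarith
  · intro s j
    have hh := half_ne q s
    have hs0 : (0 : ℚ) ≤ s := by positivity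
    fin_cases j <;> simp [alpV, betV] <;> intro h <;>
      first | linarith | (apply hh; linarith)
  · rw [cub_eval]
    exact prod_eq_zero (mem_univ 0) (by simp [betV])
  · rw [WW, if_neg (by omega)]
  · intro k
    exact tauP_mem q k (by omega)
  · intro l
    exact piP_mem q b c _ (by have := (eqv q l).2; omega)

lemma poch_rev (x : ℚ) (n : ℕ) : ∏ r ∈ range (n + 1), (x + n - r) = poch x (n + 1) := by
  rw [poch_prod, ← prod_range_reflect]
  refine prod_congr rfl fun r hr => ?_
  rw [mem_range] at hr
  rw [show n + 1 - 1 - r = n - r by omega, Nat.cast_sub (by omega)]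
  ring

lemma poch_neg (x : ℚ) (n : ℕ) : ∏ r ∈ range n, (-x - r) = (-1) ^ n * poch x n := by
  have : (-1 : ℚ) ^ n = ∏ r ∈ range n, (-1) := by simp
  rw [poch_prod, this, ← prod_mul_distrib]
  refine prod_congr rfl fun r hr => ?_
  ring

lemma poch_dup (x : ℚ) (n : ℕ) : poch (2 * x) (2 * n) = 4 ^ n * (poch x n * poch (x + 1 / 2) n) := by
  simp only [poch_prod]
  induction n with
  | zero => simp
  | succ n ih =>
    rw [show 2 * (n + 1) = 2 * n + 1 + 1 by ring, prod_range_succ, prod_range_succ, ih,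
      prod_range_succ _ n, prod_range_succ _ n]
    push_cast
    ring

lemma DR_step (q b c d : ℕ) (hb : c + 4 * q + 10 ≤ b) (hd : d + 1 ≤ c) :
    DR q b c (d + 1) * (poch ((d : ℚ) + 1) (q + 1) * poch ((b : ℚ) + c - 2 * d) (2 * (q + 1))) =
      DR q b c d * (4 ^ (q + 1) * (poch ((d : ℚ) + 1 / 2) (q + 1) * poch ((b : ℚ) - d) (q + 1) *
        poch ((c : ℚ) - d) (q + 1))) := by
  have h := Phi_step q b c (q + 1 + d) hb
  rw [DR_eq q b c (d + 1) hb hd, DR_eq q b c d hb (by omega), ← add_assoc]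
  simp only [Fin.prod_univ_three, alpV, betV, Matrix.cons_val_zero, Matrix.cons_val_one,
    Matrix.cons_val] at h
  have b1 : ∏ r ∈ range (q + 1), (((q + 1 + d : ℕ) : ℚ) - 0 - r) = poch ((d : ℚ) + 1) (q + 1) := by
    rw [← poch_rev]
    refine prod_congr rfl fun r _ => ?_
    push_cast; ring
  have b2 : ∏ r ∈ range (q + 1), (((q + 1 + d : ℕ) : ℚ) - (((b : ℚ) + c) / 2 + q + 1) - r) =
      (-1) ^ (q + 1) * poch (((b : ℚ) + c - 2 * d) / 2) (q + 1) := by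
    rw [← poch_neg]
    refine prod_congr rfl fun r _ => ?_
    push_cast; ring
  have b3 : ∏ r ∈ range (q + 1), (((q + 1 + d : ℕ) : ℚ) - (((b : ℚ) + c) / 2 + q + 3 / 2) - r) =
      (-1) ^ (q + 1) * poch (((b : ℚ) + c - 2 * d) / 2 + 1 / 2) (q + 1) := by
    rw [← poch_neg]
    refine prod_congr rfl fun r _ => ?_
    push_cast; ring
  have hneg : ∀ x : ℚ, ∏ r ∈ range (q + 1), (-(x + q) + (r : ℚ)) = (-1) ^ (q + 1) * poch x (q + 1) := by
    intro x
    have : (-1 : ℚ) ^ (q + 1) = ∏ r ∈ range (q + 1), (-1) := by simp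
    rw [← poch_rev, this, ← prod_mul_distrib]
    refine prod_congr rfl fun r _ => ?_
    ring
  have a1 : ∀ x : ℚ, ∏ r ∈ range (q + 1), (((q + 1 + d : ℕ) : ℚ) - (x + 2 * q + 1) + r) =
      (-1) ^ (q + 1) * poch (x - d) (q + 1) := by
    intro x
    rw [← hneg]
    refine prod_congr rfl fun r _ => ?_
    push_cast; ring
  have a3 : ∏ r ∈ range (q + 1), (((q + 1 + d : ℕ) : ℚ) - ((q : ℚ) + 1 / 2) + r) =
      poch ((d : ℚ) + 1 / 2) (q + 1) := by
    rw [poch_prod]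
    refine prod_congr rfl fun r _ => ?_
    push_cast; ring
  rw [b1, b2, b3, a1, a1, a3] at h
  have hdup := poch_dup (((b : ℚ) + c - 2 * d) / 2) (q + 1)
  rw [mul_div_cancel₀ _ (two_ne_zero)] at hdup
  rw [hdup]
  have hs : ((-1 : ℚ) ^ (q + 1)) * (-1) ^ (q + 1) = 1 := by
    rw [← mul_pow]; norm_num
  set F1 := Phi q (c + 2 * q + 2) (WW q b c) (fun k => tauP q k)
      (fun l => piP q b c (eqv q l)) (q + 1 + d + 1)
  set F0 := Phi q (c + 2 * q + 2) (WW q b c) (fun k => tauP q k)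
      (fun l => piP q b c (eqv q l)) (q + 1 + d)
  set e := (-1 : ℚ) ^ (q + 1)
  generalize poch (((b : ℚ) + c - 2 * d) / 2) (q + 1) = p1 at *
  generalize poch (((b : ℚ) + c - 2 * d) / 2 + 1 / 2) (q + 1) = p2 at *
  generalize poch ((d : ℚ) + 1) (q + 1) = p3 at *
  generalize poch ((d : ℚ) + 1 / 2) (q + 1) = p4 at *
  generalize poch ((b : ℚ) - d) (q + 1) = p5 at *
  generalize poch ((c : ℚ) - d) (q + 1) = p6 at *
  have h' : F1 * (p3 * p1 * p2) * (e * e) = F0 * (p6 * p5 * p4) * (e * e) := by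
    linear_combination h
  rw [hs, mul_one, mul_one] at h'
  linear_combination ((-2) ^ (q + 1) * 4 ^ (q + 1)) * h'

lemma DR_prod (q b c d : ℕ) (hb : c + 4 * q + 10 ≤ b) (hd : d ≤ c) :
    DR q b c d * ∏ k ∈ range d,
      (poch ((k : ℚ) + 1) (q + 1) * poch ((b : ℚ) + c - 2 * k) (2 * (q + 1))) =
      DR q b c 0 * ∏ k ∈ range d, (4 ^ (q + 1) * (poch ((k : ℚ) + 1 / 2) (q + 1) *
        poch ((b : ℚ) - k) (q + 1) * poch ((c : ℚ) - k) (q + 1))) := by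
  induction d with
  | zero => simp
  | succ d ih =>
    have h := DR_step q b c d hb hd
    rw [prod_range_succ, prod_range_succ, ← mul_assoc (DR q b c 0), ← ih (by omega)]
    linear_combination (∏ k ∈ range d,
      (poch ((k : ℚ) + 1) (q + 1) * poch ((b : ℚ) + c - 2 * k) (2 * (q + 1)))) * h

/-- agreeing with a polynomial from `d` on -/
def PolyOn (d : ℕ) (f : ℕ → ℚ) : Prop :=
  ∃ P : Polynomial ℚ, ∀ b : ℕ, d ≤ b → f b = P.eval (b : ℚ)

lemma PolyOn.const (d : ℕ) (x : ℚ) : PolyOn d (fun _ => x) := ⟨Polynomial.C x, by simp⟩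

lemma PolyOn.mul {d : ℕ} {f g : ℕ → ℚ} (hf : PolyOn d f) (hg : PolyOn d g) :
    PolyOn d (fun b => f b * g b) := by
  obtain ⟨P, hP⟩ := hf
  obtain ⟨R, hR⟩ := hg
  exact ⟨P * R, fun b hb => by simp only [hP b hb, hR b hb, Polynomial.eval_mul]⟩

lemma PolyOn.sub {d : ℕ} {f g : ℕ → ℚ} (hf : PolyOn d f) (hg : PolyOn d g) :
    PolyOn d (fun b => f b - g b) := by
  obtain ⟨P, hP⟩ := hf
  obtain ⟨R, hR⟩ := hg
  exact ⟨P - R, fun b hb => by simp only [hP b hb, hR b hb, Polynomial.eval_sub]⟩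

lemma PolyOn.sum {d n : ℕ} {f : ℕ → ℕ → ℚ} (hf : ∀ k < n, PolyOn d (f k)) :
    PolyOn d (fun b => ∑ k ∈ range n, f k b) := by
  choose! P hP using hf
  refine ⟨∑ k ∈ range n, P k, fun b hb => ?_⟩
  rw [Polynomial.eval_finsetSum]
  exact sum_congr rfl fun k hk => hP k (mem_range.mp hk) b hb

lemma PolyOn.prod {d n : ℕ} {f : ℕ → ℕ → ℚ} (hf : ∀ k < n, PolyOn d (f k)) :
    PolyOn d (fun b => ∏ k ∈ range n, f k b) := by
  choose! P hP using hf
  refine ⟨∏ k ∈ range n, P k, fun b hb => ?_⟩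
  rw [Polynomial.eval_prod]
  exact prod_congr rfl fun k hk => hP k (mem_range.mp hk) b hb

lemma PolyOn.det {d n : ℕ} {f : Fin n → Fin n → ℕ → ℚ} (hf : ∀ i j, PolyOn d (f i j)) :
    PolyOn d (fun b => (Matrix.of fun i j => f i j b).det) := by
  choose P hP using hf
  refine ⟨(Matrix.of P).det, fun b hb => ?_⟩
  show (Matrix.of fun i j => f i j b).det = _
  rw [← Polynomial.coe_evalRingHom, RingHom.map_det]
  congr 1
  ext i j
  simp [hP i j b hb]

lemma PolyOn.eq {d B : ℕ} {f g : ℕ → ℚ} (hf : PolyOn d f) (hg : PolyOn d g)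
    (h : ∀ b, B ≤ b → d ≤ b → f b = g b) (b : ℕ) (hb : d ≤ b) : f b = g b := by
  obtain ⟨P, hP⟩ := hf
  obtain ⟨R, hR⟩ := hg
  have : P = R := by
    refine Polynomial.eq_of_infinite_eval_eq P R ?_
    have hinf : Set.Infinite ((fun n : ℕ => (n : ℚ)) '' Set.Ici (max B d)) :=
      (Set.Ici_infinite _).image (Nat.cast_injective.injOn)
    refine hinf.mono ?_
    rintro _ ⟨n, hn, rfl⟩
    have h1 : max B d ≤ n := hn
    show P.eval (n : ℚ) = R.eval (n : ℚ)
    rw [← hP n (by omega), ← hR n (by omega)]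
    exact h n (by omega) (by omega)
  rw [hP b hb, hR b hb, this]

lemma PolyOn.ibinom (d : ℕ) (x k : ℤ) (hx : 0 ≤ (d : ℤ) + x) :
    PolyOn d (fun b => ibinom ((b : ℤ) + x) k) := by
  rcases lt_or_ge k 0 with h | h
  · exact ⟨0, fun b _ => by
      show _root_.ibinom ((b : ℤ) + x) k = _
      rw [ibinom_neg _ _ h]; simp⟩
  · obtain ⟨k, rfl⟩ := Int.eq_ofNat_of_zero_le h
    refine ⟨Polynomial.C (1 / (k.factorial : ℚ)) *
      (descPochhammer ℚ k).comp (Polynomial.X + Polynomial.C (x : ℚ)), fun b hb => ?_⟩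
    obtain ⟨n, hn⟩ := Int.eq_ofNat_of_zero_le (by omega : 0 ≤ (b : ℤ) + x)
    have hn' : (b : ℚ) + x = n := by exact_mod_cast hn
    show _root_.ibinom ((b : ℤ) + x) k = _
    rw [hn, ibinom_nat]
    simp only [Polynomial.eval_mul, Polynomial.eval_C, Polynomial.eval_comp, Polynomial.eval_add,
      Polynomial.eval_X, hn']
    rw [descPochhammer_eval_eq_descFactorial, Nat.descFactorial_eq_factorial_mul_choose]
    have : (k.factorial : ℚ) ≠ 0 := by positivity
    push_cast
    field_simp

lemma PolyOn.poch (d n : ℕ) (x : ℚ) : PolyOn d (fun b => poch ((b : ℚ) + x) n) :=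
  ⟨(ascPochhammer ℚ n).comp (Polynomial.X + Polynomial.C x), fun b _ => by
    simp only [_root_.poch, Polynomial.eval_comp, Polynomial.eval_add, Polynomial.eval_X,
      Polynomial.eval_C]⟩

lemma PolyOn.DR (q c d e : ℕ) (hd : d ≤ c) (he : e ≤ d) : PolyOn d (fun b => DR q b c e) := by
  unfold _root_.DR
  refine PolyOn.det (f := fun i j b => RR q b c e i j) fun i j => ?_
  unfold RR
  refine PolyOn.sub (PolyOn.ibinom d c _ (by omega)) (PolyOn.sum fun s hs => ?_)
  refine PolyOn.mul (PolyOn.const _ _) ?_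
  have := PolyOn.ibinom d ((c : ℤ) - 1 - 2 * s) ((c : ℤ) + (j : ℕ) - (q + 1) - s) (by omega)
  simpa only [add_sub_assoc] using this

lemma DR_prod' (q b c d : ℕ) (hb : d ≤ b) (hd : d ≤ c) :
    DR q b c d * ∏ k ∈ range d,
      (poch ((k : ℚ) + 1) (q + 1) * poch ((b : ℚ) + c - 2 * k) (2 * (q + 1))) =
      DR q b c 0 * ∏ k ∈ range d, (4 ^ (q + 1) * (poch ((k : ℚ) + 1 / 2) (q + 1) *
        poch ((b : ℚ) - k) (q + 1) * poch ((c : ℚ) - k) (q + 1))) := by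
  refine PolyOn.eq (d := d) (B := c + 4 * q + 10)
    (f := fun b : ℕ => DR q b c d * ∏ k ∈ range d,
      (poch ((k : ℚ) + 1) (q + 1) * poch ((b : ℚ) + c - 2 * k) (2 * (q + 1))))
    (g := fun b : ℕ => DR q b c 0 * ∏ k ∈ range d, (4 ^ (q + 1) * (poch ((k : ℚ) + 1 / 2) (q + 1) *
        poch ((b : ℚ) - k) (q + 1) * poch ((c : ℚ) - k) (q + 1)))) ?_ ?_
    (fun b hb _ => DR_prod q b c d hb hd) b hb
  · refine (PolyOn.DR q c d d hd le_rfl).mul (PolyOn.prod fun k _ => (PolyOn.const _ _).mul ?_)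
    have := PolyOn.poch d (2 * (q + 1)) ((c : ℚ) - 2 * k)
    simpa only [add_sub_assoc] using this
  · refine (PolyOn.DR q c d 0 hd (by omega)).mul (PolyOn.prod fun k _ => (PolyOn.const _ _).mul
      (((PolyOn.const _ _).mul ?_).mul (PolyOn.const _ _)))
    have := PolyOn.poch d (q + 1) (-(k : ℚ))
    simpa only [← sub_eq_add_neg] using this

lemma prod_desc' (s k : ℕ) (h : s < k) : ∏ u ∈ range k, ((s : ℚ) - u) = 0 :=
  prod_eq_zero (i := s) (by rw [mem_range]; omega) (sub_self _)

/-- column polynomials for the lateral block -/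
def rhoP (a b c j : ℕ) : Polynomial ℚ :=
  (∏ u ∈ range (a - j), (Polynomial.C ((c : ℚ) + a - u) - Polynomial.X)) *
    ∏ u ∈ range j, (Polynomial.X + Polynomial.C ((b : ℚ) - u))

lemma rhoP_eval (a b c j : ℕ) (x : ℚ) : (rhoP a b c j).eval x =
    (∏ u ∈ range (a - j), ((c : ℚ) + a - x - u)) * ∏ u ∈ range j, ((b : ℚ) + x - u) := by
  rw [rhoP]
  simp only [Polynomial.eval_mul, Polynomial.eval_C, Polynomial.eval_prod, Polynomial.eval_sub,
    Polynomial.eval_X, Polynomial.eval_add]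
  congr 1 <;> exact prod_congr rfl fun u _ => by ring

lemma rhoP_choose (a b c i j : ℕ) (hi : i ≤ a) (hj : j ≤ a) :
    (rhoP a b c j).eval (i : ℚ) * ((b + c).factorial : ℚ) =
      ((c + a - i).factorial : ℚ) * ((b + i).factorial : ℚ) *
        ibinom ((b : ℤ) + c) ((c : ℤ) - i + j) := by
  have e1 : (c : ℚ) + a - i = ((c + a - i : ℕ) : ℚ) := by
    rw [Nat.cast_sub (by omega)]; push_cast; ring
  have e2 : (b : ℚ) + i = ((b + i : ℕ) : ℚ) := by push_cast; ring
  rw [rhoP_eval, e1, e2]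
  rcases lt_or_ge (c + j) i with h | h
  · rw [prod_desc' _ _ (by omega), ibinom_neg _ _ (by omega)]; ring
  rcases lt_or_ge (b + i) j with h' | h'
  · rw [prod_desc' (b + i) j (by omega), ibinom, if_neg (by omega)]; ring
  have h1 := prod_desc (c + a - i) (a - j) (by omega)
  have h2 := prod_desc (b + i) j h'
  rw [show (c : ℤ) - i + j = ((c + j - i : ℕ) : ℤ) by omega,
    show (b : ℤ) + c = ((b + c : ℕ) : ℤ) by push_cast; ring, ibinom_nat,
    Nat.cast_choose ℚ (by omega), ← h1, ← h2, show c + a - i - (a - j) = c + j - i by omega,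
    show b + c - (c + j - i) = b + i - j by omega]
  have f3 : ((c + j - i).factorial : ℚ) ≠ 0 := by positivity
  have f4 : ((b + i - j).factorial : ℚ) ≠ 0 := by positivity
  field_simp

open Polynomial in
lemma rhoP_deg (a b c j : ℕ) (hj : j ≤ a) : (rhoP a b c j).natDegree ≤ a := by
  have h0 : ∀ x : ℚ, (C x - X).natDegree ≤ 1 := by
    intro x; compute_degree
  have h0' : ∀ x : ℚ, (X + C x).natDegree ≤ 1 := by
    intro x; compute_degree
  have h1 := natDegree_prod_lin (a - j) (fun u => C ((c : ℚ) + a - u) - X)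
    (fun s => h0 _)
  have h2 := natDegree_prod_lin j (fun u => X + C ((b : ℚ) - u))
    (fun s => h0' _)
  have h3 := natDegree_mul_le (p := ∏ u ∈ range (a - j), (C ((c : ℚ) + a - u) - X))
    (q := ∏ u ∈ range j, (X + C ((b : ℚ) - u)))
  rw [rhoP]
  omega

lemma Q2_ne (a b c : ℕ) : (Matrix.of fun i j : Fin (a + 1) =>
    ibinom ((b : ℤ) + c) ((c : ℤ) - (i : ℕ) + (j : ℕ))).det ≠ 0 := by
  intro h0
  obtain ⟨v, hv, hv0⟩ := Matrix.exists_mulVec_eq_zero_iff.mpr h0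
  have hP : ∑ j, Polynomial.C (v j) * rhoP a b c j = 0 := by
    refine Polynomial.eq_zero_of_natDegree_lt_card_of_eval_eq_zero _
      (f := fun i : Fin (a + 1) => ((i : ℕ) : ℚ)) ?_ ?_ ?_
    · intro i j hij
      have hij' : ((i : ℕ) : ℚ) = ((j : ℕ) : ℚ) := hij
      exact Fin.ext (by exact_mod_cast hij')
    · intro i
      have hi := congrFun hv0 i
      rw [Matrix.mulVec, dotProduct] at hi
      simp only [Matrix.of_apply, Pi.zero_apply] at hi
      rw [Polynomial.eval_finsetSum]
      have hf : ((b + c).factorial : ℚ) ≠ 0 := by positivity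
      apply mul_right_cancel₀ hf
      rw [zero_mul, sum_mul, ← mul_zero (((c + a - i).factorial : ℚ) * ((b + i).factorial : ℚ)), ← hi,
        mul_sum]
      refine sum_congr rfl fun j _ => ?_
      have := rhoP_choose a b c i j (by omega) (by omega)
      simp only [Polynomial.eval_mul, Polynomial.eval_C]
      linear_combination v j * this
    · rw [Fintype.card_fin, Nat.lt_succ_iff]
      refine Polynomial.natDegree_sum_le_of_forall_le _ _ fun j _ => ?_
      exact (Polynomial.natDegree_C_mul_le _ _).trans (rhoP_deg a b c j (by omega))
  let T : Matrix (Fin (a + 1)) (Fin (a + 1)) ℚ :=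
    Matrix.of fun i j => (rhoP a b c j).eval ((c : ℚ) + (i : ℕ))
  have hT : T.det ≠ 0 := by
    rw [Matrix.det_of_isUpperTriangular, prod_ne_zero_iff]
    · intro j _
      simp only [T, Matrix.of_apply]
      rw [rhoP_eval]
      refine mul_ne_zero (prod_ne_zero_iff.mpr fun u hu => ?_) (prod_ne_zero_iff.mpr fun u hu => ?_)
      · rw [mem_range] at hu
        have : ((j : ℕ) : ℚ) + u + 1 ≤ a := by exact_mod_cast (by omega : (j : ℕ) + u + 1 ≤ a)
        intro h; linarith
      · rw [mem_range] at hu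
        have : (u : ℚ) + 1 ≤ (j : ℕ) := by exact_mod_cast hu
        have hb : (0 : ℚ) ≤ b := by positivity
        have hc : (0 : ℚ) ≤ c := by positivity
        intro h; linarith
    · intro i j hij
      have hij' : (j : ℕ) < i := hij
      simp only [T, Matrix.of_apply]
      rw [rhoP_eval, prod_eq_zero (s := range (a - j)) (i := a - i) (by rw [mem_range]; omega),
        zero_mul]
      rw [Nat.cast_sub (by omega)]
      ring
  refine hv (Matrix.eq_zero_of_mulVec_eq_zero hT ?_)
  funext i
  have := congrArg (Polynomial.eval ((c : ℚ) + (i : ℕ))) hP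
  rw [Polynomial.eval_finsetSum] at this
  simp only [Polynomial.eval_mul, Polynomial.eval_C, Polynomial.eval_zero] at this
  rw [Matrix.mulVec, dotProduct, Pi.zero_apply, ← this]
  exact sum_congr rfl fun j _ => by simp only [T, Matrix.of_apply]; ring

lemma Q4_det (d : ℕ) : (Matrix.of fun i j : Fin d =>
    ibinom (2 * (((j : ℕ) : ℤ) - ((i : ℕ) : ℤ))) (((j : ℕ) : ℤ) - ((i : ℕ) : ℤ))).det = 1 := by
  rw [Matrix.det_of_isUpperTriangular]
  · refine prod_eq_one fun i _ => ?_
    simp [ibinom]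
  · intro i j hij
    have h : (j : ℕ) < i := hij
    exact ibinom_neg _ _ (by omega)

lemma Q1_eq (q d i j : ℕ) (hi : i < 2 * (q + 1)) (hj : j < d) :
    ibinom (2 * ((j : ℤ) + 1) - 1) (((j : ℤ) + 1) - ((i : ℤ) + 1) + ((q + 1 : ℕ) : ℤ)) =
      ∑ s ∈ range d, al q (kap q i) (q + 1 + s) * ibinom (2 * ((j : ℤ) - s)) ((j : ℤ) - s) := by
  have hk : kap q i ≤ q := by unfold kap; split_ifs <;> omega
  rw [ida q (kap q i) j d hk hj]
  rcases le_or_gt i q with h | h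
  · rw [← ida']
    have : kap q i = q - i := by rw [kap, if_pos h]
    rw [this]
    congr 1 <;> omega
  · have : kap q i = i - (q + 1) := by rw [kap, if_neg (by omega)]
    rw [this]
    congr 1 <;> omega

lemma schur_core (q b c d : ℕ) (Q2 : Matrix (Fin (2 * (q + 1))) (Fin (2 * (q + 1))) ℚ)
    (Q1 : Matrix (Fin (2 * (q + 1))) (Fin d) ℚ) (Q3 : Matrix (Fin d) (Fin (2 * (q + 1))) ℚ)
    (Q4 : Matrix (Fin d) (Fin d) ℚ)
    (h2 : Q2 = Matrix.of fun (i : Fin (2 * (q + 1))) (j : Fin (2 * (q + 1))) =>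
      ibinom ((b : ℤ) + c) ((c : ℤ) - (((i : ℕ) : ℤ) + 1) + (((j : ℕ) : ℤ) + 1)))
    (h1 : Q1 = Matrix.of fun (i : Fin (2 * (q + 1))) (j : Fin d) => ibinom (2 * (((j : ℕ) : ℤ) + 1) - 1)
      ((((j : ℕ) : ℤ) + 1) - (((i : ℕ) : ℤ) + 1) + ((q + 1 : ℕ) : ℤ)))
    (h3 : Q3 = Matrix.of fun (i : Fin d) (j : Fin (2 * (q + 1))) => ibinom ((b : ℤ) + c - 2 * (((i : ℕ) : ℤ) + 1) + 1)
        ((c : ℤ) - (((i : ℕ) : ℤ) + 1) + (((j : ℕ) : ℤ) + 1) - ((q + 1 : ℕ) : ℤ)))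
    (h4 : Q4 = Matrix.of fun (i : Fin d) (j : Fin d) =>
      ibinom (2 * (((j : ℕ) : ℤ) - ((i : ℕ) : ℤ))) (((j : ℕ) : ℤ) - ((i : ℕ) : ℤ))) :
    DR q b c 0 ≠ 0 ∧ DR q b c 0 * (Q4 - Q3 * Q2⁻¹ * Q1).det = DR q b c d := by
  have e2 : Q2.det = DR q b c 0 := by
    rw [h2, DR]
    congr 1
    ext i j
    simp only [Matrix.of_apply, RR, range_zero, sum_empty, sub_zero]
    congr 1
    ring
  have hne : Q2.det ≠ 0 := by
    have := Q2_ne (2 * q + 1) b c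
    change (Matrix.of fun i j : Fin (2 * (q + 1)) =>
      ibinom ((b : ℤ) + c) ((c : ℤ) - (i : ℕ) + (j : ℕ))).det ≠ 0 at this
    have hQ : Q2 = Matrix.of fun i j : Fin (2 * (q + 1)) =>
        ibinom ((b : ℤ) + c) ((c : ℤ) - (i : ℕ) + (j : ℕ)) := by
      rw [h2]
      ext i j
      simp only [Matrix.of_apply]
      congr 1
      ring
    rw [hQ]
    exact this
  refine ⟨e2 ▸ hne, ?_⟩
  let Al : Matrix (Fin (2 * (q + 1))) (Fin d) ℚ :=
    Matrix.of fun i s => al q (kap q i) (q + 1 + (s : ℕ))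
  have hQ1 : Q1 = Al * Q4 := by
    ext i j
    rw [Matrix.mul_apply, h1, h4]
    simp only [Matrix.of_apply, Al]
    rw [Q1_eq q d i j i.2 j.2]
    exact (Fin.sum_univ_eq_sum_range (fun s => al q (kap q i) (q + 1 + s) *
      ibinom (2 * (((j : ℕ) : ℤ) - s)) (((j : ℕ) : ℤ) - s)) d).symm
  have hR : (Q2 - Al * Q3) = Matrix.of fun i j : Fin (2 * (q + 1)) => RR q b c d i j := by
    ext i j
    rw [Matrix.sub_apply, Matrix.mul_apply, h2, h3]
    simp only [Matrix.of_apply, Al, RR]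
    rw [← Fin.sum_univ_eq_sum_range (fun s => al q (kap q i) (q + 1 + s) *
      ibinom ((b : ℤ) + c - 1 - 2 * s) ((c : ℤ) + (j : ℕ) - (q + 1) - s)) d]
    congr 1
    · congr 1; ring
    · refine sum_congr rfl fun s _ => ?_
      congr 2
      · ring
      · push_cast; ring
  have hb : Matrix.fromBlocks Q2 Q1 Q3 Q4 =
      Matrix.fromBlocks 1 Al 0 1 * Matrix.fromBlocks (Q2 - Al * Q3) 0 Q3 Q4 := by
    rw [Matrix.fromBlocks_multiply]
    simp [hQ1]
  have d1 : (Matrix.fromBlocks Q2 Q1 Q3 Q4).det = DR q b c d := by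
    have : Q4.det = 1 := by rw [h4]; exact Q4_det d
    rw [hb, Matrix.det_mul, Matrix.det_fromBlocks_zero₂₁, Matrix.det_fromBlocks_zero₁₂, hR, this]
    simp [DR]
  have : Invertible Q2 := Matrix.invertibleOfIsUnitDet Q2 (isUnit_iff_ne_zero.mpr hne)
  rw [← d1, Matrix.det_fromBlocks₁₁, Matrix.invOf_eq_nonsing_inv, e2]

lemma prod_Icc_one (d : ℕ) (f : ℕ → ℚ) : ∏ k ∈ Finset.Icc 1 d, f k = ∏ k ∈ range d, f (k + 1) := by
  induction d with
  | zero => simp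
  | succ n ih => rw [Finset.prod_Icc_succ_top (by omega), prod_range_succ, ih]

lemma poch_pos' (x : ℚ) (n : ℕ) (hx : 0 < x) : 0 < poch x n := by
  rw [poch_prod]
  exact prod_pos fun r _ => by positivity

/-- For `a = 2p`, the Schur complement `F = Q₄ − Q₃·Q₂⁻¹·Q₁` has a nicely factored
determinant. -/
theorem schur_complement_det_factors (p b c d : ℕ) (hd : d ≤ min b c) :
    let a : ℕ := 2 * p
    let Q2 : Matrix (Fin a) (Fin a) ℚ := Matrix.of fun i j =>
      ibinom ((b : ℤ) + c) ((c : ℤ) - (((i : ℕ) : ℤ) + 1) + (((j : ℕ) : ℤ) + 1))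
    let Q1 : Matrix (Fin a) (Fin d) ℚ := Matrix.of fun i j =>
      ibinom (2 * (((j : ℕ) : ℤ) + 1) - 1) ((((j : ℕ) : ℤ) + 1) - (((i : ℕ) : ℤ) + 1) + (p : ℤ))
    let Q3 : Matrix (Fin d) (Fin a) ℚ := Matrix.of fun i j =>
      ibinom ((b : ℤ) + c - 2 * (((i : ℕ) : ℤ) + 1) + 1)
        ((c : ℤ) - (((i : ℕ) : ℤ) + 1) + (((j : ℕ) : ℤ) + 1) - (p : ℤ))
    let Q4 : Matrix (Fin d) (Fin d) ℚ := Matrix.of fun i j =>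
      ibinom (2 * (((j : ℕ) : ℤ) - ((i : ℕ) : ℤ))) (((j : ℕ) : ℤ) - ((i : ℕ) : ℤ))
    (Q4 - Q3 * Q2⁻¹ * Q1).det =
      (4 : ℚ) ^ (d * p) *
        ∏ k ∈ Finset.Icc 1 d,
          poch ((k : ℚ) - 1 / 2) p * poch ((b : ℚ) - k + 1) p * poch ((c : ℚ) - k + 1) p /
            (poch (k : ℚ) p * poch ((b : ℚ) + c - 2 * k + 2) (2 * p)) := by
  intro a Q2 Q1 Q3 Q4
  have hb : d ≤ b := le_trans hd (min_le_left _ _)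
  have hc : d ≤ c := le_trans hd (min_le_right _ _)
  rcases p with _ | q
  · have hz : Q3 * Q2⁻¹ * Q1 = 0 := by
      ext i j
      rw [Matrix.mul_apply]
      exact Fintype.sum_eq_zero _ fun x => absurd x.2 (by simp [a])
    rw [hz, sub_zero, show Q4.det = 1 from Q4_det d]
    simp [poch]
  · obtain ⟨hne, hF⟩ := schur_core q b c d Q2 Q1 Q3 Q4 rfl rfl rfl rfl
    have hP := DR_prod' q b c d hb hc
    rw [← hF, mul_assoc] at hP
    have hP' := mul_left_cancel₀ hne hP
    have hden : ∏ k ∈ range d,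
        (poch ((k : ℚ) + 1) (q + 1) * poch ((b : ℚ) + c - 2 * k) (2 * (q + 1))) ≠ 0 := by
      refine prod_ne_zero_iff.mpr fun k hk => ?_
      rw [mem_range] at hk
      have h1 : (k : ℚ) + 1 ≤ b := by exact_mod_cast (by omega : k + 1 ≤ b)
      have h2 : (k : ℚ) + 1 ≤ c := by exact_mod_cast (by omega : k + 1 ≤ c)
      exact mul_ne_zero (poch_pos' _ _ (by positivity)).ne' (poch_pos' _ _ (by linarith)).ne'
    rw [eq_div_of_mul_eq hden hP', ← prod_div_distrib, prod_Icc_one,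
      show (4 : ℚ) ^ (d * (q + 1)) = ∏ k ∈ range d, (4 : ℚ) ^ (q + 1) by
        rw [prod_const, card_range, ← pow_mul, mul_comm], ← prod_mul_distrib]
    refine prod_congr rfl fun k _ => ?_
    push_cast
    rw [show (k : ℚ) + 1 - 1 / 2 = k + 1 / 2 by ring, show (b : ℚ) - (k + 1) + 1 = b - k by ring,
      show (c : ℚ) - (k + 1) + 1 = c - k by ring,
      show (b : ℚ) + c - 2 * (k + 1) + 2 = b + c - 2 * k by ring, mul_div_assoc]
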